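/- arXiv:2202.08140 — 2 statements merged into one kernel-verified Lean document; each statement's English description precedes it below -/
import Mathlib

section
/- Let A be a weakly Rickart C*-algebra and let x ∈ A. Then x admits a polar decomposition inside A: there exists a partial isometry e ∈ A such that x = e (x* x)^{1/2}, e e* = LP(x) and e* e = RP(x). -/
/-- A projection in a C*-algebra: a self-adjoint idempotent. -/
def IsProjection {A : Type*} [Mul A] [Star A] (p : A) : Prop :=
  star p = p ∧ p * p = p

/-- A partial isometry: an element `e` such that `e * e*` is a projection. -/
def IsPartialIsometry {A : Type*} [Mul A] [Star A] (e : A) : Prop :=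
  IsProjection (e * star e)

/-- `p` is an annihilating right projection (ARP) of `x`. -/
def IsARP {A : Type*} [Mul A] [Star A] [Zero A] (x p : A) : Prop :=
  IsProjection p ∧ x * p = x ∧ ∀ y : A, x * y = 0 → p * y = 0

/-- `q` is an annihilating left projection (ALP) of `x`. -/
def IsALP {A : Type*} [Mul A] [Star A] [Zero A] (x q : A) : Prop :=
  IsProjection q ∧ q * x = x ∧ ∀ y : A, y * x = 0 → y * q = 0

/-- A C*-algebra is weakly Rickart if every element admits an ARP. -/
def WeaklyRickart (A : Type*) [NonUnitalCStarAlgebra A] : Prop :=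
  ∀ x : A, ∃ p : A, IsARP x p

section Semigroup

variable {S : Type*} [Semigroup S]

theorem mul_mul_of_mul_eq {a b c : S} (h : a * b = c) (z : S) : a * (b * z) = c * z := by
  rw [← mul_assoc, h]

end Semigroup

section NonUnitalCStar

variable {A : Type*} [NonUnitalCStarAlgebra A]

theorem IsProjection.norm_le_one {p : A} (hp : IsProjection p) : ‖p‖ ≤ 1 := by
  have h : ‖p‖ * ‖p‖ = ‖p‖ := by
    rw [← CStarRing.norm_star_mul_self, hp.1, hp.2]
  nlinarith [norm_nonneg p, sq_nonneg (‖p‖ - 1)]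

theorem norm_le_one_of_isProjection_star_mul_self {u : A} (hu : IsProjection (star u * u)) :
    ‖u‖ ≤ 1 := by
  have h := hu.norm_le_one
  rw [CStarRing.norm_star_mul_self] at h
  nlinarith [norm_nonneg u]

theorem isProjection_zero : IsProjection (0 : A) := by simp [IsProjection]

theorem mul_star_self_mul_of_isProjection {u : A} (hu : IsProjection (star u * u)) :
    u * (star u * u) = u := by
  rw [← sub_eq_zero, ← CStarRing.star_mul_self_eq_zero_iff]
  have h := hu.2
  simp only [star_sub, star_mul, star_star, mul_sub, sub_mul, mul_assoc] at h ⊢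
  simp [h]

theorem isProjection_mul_star_self {u : A} (hu : u * (star u * u) = u) :
    IsProjection (u * star u) := by
  refine ⟨by simp, ?_⟩
  rw [mul_assoc, ← mul_assoc (star u), ← mul_assoc, hu]

theorem isProjection_star_mul_self {u : A} (hu : u * (star u * u) = u) :
    IsProjection (star u * u) :=
  ⟨by simp, by rw [mul_assoc, hu]⟩

theorem WeaklyRickart.exists_isALP (hA : WeaklyRickart A) (x : A) : ∃ q, IsALP x q := by
  obtain ⟨p, hp, h1, h2⟩ := hA (star x)
  refine ⟨p, hp, ?_, fun y hy => ?_⟩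
  · simpa [hp.1] using congrArg star h1
  · have := h2 (star y) (by rw [← star_mul, hy, star_zero])
    simpa [hp.1] using congrArg star this

theorem IsALP.eq_of_mul_eq {x p y z : A} (hp : IsALP x p) (h : y * x = z * x) :
    y * p = z * p := by
  have := hp.2.2 (y - z) (by rw [sub_mul, h, sub_self])
  rwa [sub_mul, sub_eq_zero] at this

theorem IsALP.mul_of_star_mul_eq_zero {x p y : A} (hp : IsALP x p) (h : star y * x = 0) :
    p * y = 0 := by
  have := hp.2.2 _ h
  simpa [hp.1.1] using congrArg star this

theorem IsALP.mul_mul_eq {x p : A} (hp : IsALP x p) {y : A} (h : y * x = x) : y * p = p := by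
  have := hp.eq_of_mul_eq (y := y) (z := p) (by rw [h, hp.2.1])
  rw [this, hp.1.2]

/-- A factorization `w * b = a` with `star a * a = star b * b` can be cut down to a partial
isometry between the left projections. -/
theorem WeaklyRickart.exists_partialIsometry (hA : WeaklyRickart A) {a b w : A}
    (hab : star a * a = star b * b) (hw : w * b = a) :
    ∃ v : A, v * b = a ∧ IsALP b (star v * v) ∧ IsALP a (v * star v) := by
  obtain ⟨e, he⟩ := hA.exists_isALP b
  have heb : e * b = b := he.2.1
  have hee : e * e = e := he.1.2
  have hes : star e = e := he.1.1
  have key : star (w * e) * (w * e) = e := by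
    have h1 : star b * (star (w * e) * (w * e) - e) * b = 0 := by
      have : star b * (star (w * e) * (w * e) - e) * b
          = star (w * (e * b)) * (w * (e * b)) - star b * (e * b) := by
        simp only [star_mul, mul_sub, sub_mul, mul_assoc]
      rw [this, heb, hw, hab, sub_self]
    have hXe : (star (w * e) * (w * e) - e) * e = star (w * e) * (w * e) - e := by
      simp only [sub_mul, mul_assoc, hee]
    have h2 : star b * (star (w * e) * (w * e) - e) = 0 := by
      have := he.2.2 _ h1
      rwa [mul_assoc, hXe] at this
    have h3 : (star (w * e) * (w * e) - e) * b = 0 := by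
      simpa [hes] using congrArg star h2
    have h4 := he.2.2 _ h3
    rw [hXe, sub_eq_zero] at h4
    exact h4
  have hvb : w * e * b = a := by rw [mul_assoc, heb, hw]
  have hve : (w * e) * (star (w * e) * (w * e)) = w * e := by rw [key, mul_assoc, hee]
  refine ⟨w * e, hvb, by rwa [key], isProjection_mul_star_self hve, ?_, fun y hy => ?_⟩
  · rw [← hvb, mul_assoc, ← mul_assoc (star (w * e)), ← mul_assoc, hve]
  · have h5 : y * (w * e) = 0 := by
      have := he.2.2 (y * (w * e)) (by rw [mul_assoc, hvb, hy])
      simpa only [mul_assoc, hee] using this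
    rw [← mul_assoc, h5, zero_mul]

/-- Polar decomposition when the ranges of `a` and `b` are orthogonal: the left projection of
`a + b` is the projection onto the graph of the isometry sought. -/
theorem WeaklyRickart.exists_mul_eq_of_star_mul_eq_zero (hA : WeaklyRickart A) {a b : A}
    (hab : star a * a = star b * b) (h0 : star b * a = 0) :
    ∃ v : A, v * b = a ∧ IsALP b (star v * v) ∧ IsALP a (v * star v) := by
  have h0' : star a * b = 0 := by simpa using congrArg star h0
  obtain ⟨g, hg⟩ := hA.exists_isALP (a + b)
  obtain ⟨f, hf⟩ := hA.exists_isALP a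
  have h1 : (star a - star b) * g = 0 := hg.2.2 _ (by
    simp only [sub_mul, mul_add, hab, h0, h0']; abel)
  have h2 : g * a = g * b := by
    have := congrArg star h1
    simp only [star_mul, star_sub, star_star, hg.1.1, star_zero, mul_sub] at this
    exact sub_eq_zero.mp this
  have h3 : g * b + g * b = a + b := by
    calc g * b + g * b = g * (a + b) := by rw [mul_add, h2]
      _ = a + b := hg.2.1
  have hfb : f * b = 0 := hf.mul_of_star_mul_eq_zero h0
  refine hA.exists_partialIsometry (w := f * g + f * g) hab ?_
  rw [add_mul, mul_assoc, ← mul_add, h3, mul_add, hf.2.1, hfb, add_zero]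

end NonUnitalCStar

section Ordered

variable {A : Type*} [NonUnitalCStarAlgebra A] [PartialOrder A] [StarOrderedRing A]

theorem mul_eq_zero_of_star_mul_self_le {a b z : A} (h : star a * a ≤ star b * b)
    (hz : b * z = 0) : a * z = 0 := by
  rw [← CStarRing.star_mul_self_eq_zero_iff]
  have h1 := star_left_conjugate_le_conjugate h z
  have h2 : star z * (star b * b) * z = 0 := by simp only [mul_assoc, hz, mul_zero]
  rw [h2] at h1
  refine le_antisymm ?_ (star_mul_self_nonneg _)
  simpa only [star_mul, mul_assoc] using h1

theorem mul_eq_of_star_mul_self_le {a b e : A} (he : IsProjection e)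
    (h : star a * a ≤ star b * b) (hb : b * e = b) : a * e = a := by
  have h1 : a * (star a - e * star a) = 0 :=
    mul_eq_zero_of_star_mul_self_le h (by rw [mul_sub, ← mul_assoc, hb, sub_self])
  have h2 : (a - a * e) * star (a - a * e) = 0 := by
    have e2 := he.2
    simp only [star_sub, star_mul, he.1, mul_sub, sub_mul, mul_assoc] at h1 ⊢
    rw [mul_mul_of_mul_eq e2, h1, sub_self, sub_zero]
  rw [CStarRing.mul_star_self_eq_zero_iff, sub_eq_zero] at h2
  exact h2.symm

/-- Douglas factorization of `a` through the self-adjoint element `b`, given a copy, orthogonal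
to the ranges of `a` and `b`, of the support of `b`. -/
theorem WeaklyRickart.exists_mul_eq_of_le (hA : WeaklyRickart A) {a b v : A}
    (hb : star b = b) (hab : star a * a ≤ b * b) (hba : b * a = 0)
    (hv : IsProjection (star v * v)) (hvb : star v * v * b = b)
    (hbv : b * v = 0) (hav : star a * v = 0) :
    ∃ c : A, c * b = a := by
  have hbe : b * (star v * v) = b := by simpa [hb] using congrArg star hvb
  have hD : 0 ≤ b * b - star a * a := sub_nonneg.mpr hab
  set y := CFC.sqrt (b * b - star a * a) with hy
  have hys : star y = y := (CFC.sqrt_nonneg _ : 0 ≤ y).isSelfAdjoint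
  have hyy : y * y = b * b - star a * a := CFC.sqrt_mul_sqrt_self _
  have hye : y * (star v * v) = y := by
    refine mul_eq_of_star_mul_self_le (b := b) hv ?_ hbe
    rw [hys, hb, hyy]
    exact sub_le_self _ (star_mul_self_nonneg _)
  have hva : star v * a = 0 := by simpa using congrArg star hav
  obtain ⟨q, hq⟩ := hA.exists_isALP a
  have hqv : q * v = 0 := hq.mul_of_star_mul_eq_zero hva
  obtain ⟨w, hw, -⟩ := hA.exists_mul_eq_of_star_mul_eq_zero (a := a + v * y) (b := b)
    (by
      simp only [star_add, star_mul, hys, hb, add_mul, mul_add, mul_assoc,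
        mul_mul_of_mul_eq hav, hva, zero_mul, mul_zero, add_zero, zero_add]
      rw [← mul_assoc (star v), ← mul_assoc, hye, hyy]; abel)
    (by rw [hb, mul_add, hba, ← mul_assoc, hbv, zero_mul, add_zero])
  refine ⟨q * w, ?_⟩
  rw [mul_assoc, hw, mul_add, hq.2.1, ← mul_assoc, hqv, zero_mul, add_zero]

/-- Factorization of `a` through `b` given two further orthogonal copies `x`, `y` of `b`. -/
theorem WeaklyRickart.exists_mul_eq_of_copies (hA : WeaklyRickart A) {a b x y : A}
    (hb : star b = b) (ha : star a * a = b * b) (hx : star x * x = b * b)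
    (hy : star y * y = b * b) (hbx : b * x = 0) (hby : b * y = 0) (hxy : star x * y = 0) :
    ∃ c : A, c * b = a := by
  obtain ⟨α, hα, hαe, hαx⟩ := hA.exists_mul_eq_of_star_mul_eq_zero (a := x) (b := b)
    (by rw [hx, hb]) (by rw [hb, hbx])
  obtain ⟨β, hβ, hβe, hβy⟩ := hA.exists_mul_eq_of_star_mul_eq_zero (a := y) (b := b)
    (by rw [hy, hb]) (by rw [hb, hby])
  obtain ⟨e, he⟩ : ∃ e, e = star α * α := ⟨_, rfl⟩
  rw [← he] at hαe
  have hβe' : star β * β = e := by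
    have h1 := hαe.mul_mul_eq hβe.2.1
    have h2 := hβe.mul_mul_eq hαe.2.1
    have h3 := congrArg star h1
    simp only [star_mul, star_star, hαe.1.1] at h3
    rw [← h2, h3]
  rw [hβe'] at hβe
  have hee : e * e = e := hαe.1.2
  have hes : star e = e := hαe.1.1
  have heb : e * b = b := hαe.2.1
  have hbe : b * e = b := by simpa [hb, hes] using congrArg star heb
  have hαE : α * e = α := by
    rw [he]; exact mul_star_self_mul_of_isProjection (he ▸ hαe.1)
  have hβE : β * e = β := by
    rw [← hβe']; exact mul_star_self_mul_of_isProjection (hβe' ▸ hβe.1)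
  have haE : a * e = a := mul_eq_of_star_mul_self_le (b := b) hαe.1 (by rw [ha, hb]) hbe
  obtain ⟨f, hf⟩ : ∃ f, f = α * star α := ⟨_, rfl⟩
  obtain ⟨g, hg⟩ : ∃ g, g = β * star β := ⟨_, rfl⟩
  rw [← hf] at hαx
  rw [← hg] at hβy
  have hfα : f * α = α := by
    rw [hf, mul_assoc, ← he, hαE]
  have hgβ : g * β = β := by
    rw [hg, mul_assoc, hβe', hβE]
  have hef : e * f = 0 := hαx.2.2 _ (hαe.mul_of_star_mul_eq_zero (by
    simpa [hb] using congrArg star hbx))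
  have heg : e * g = 0 := hβy.2.2 _ (hαe.mul_of_star_mul_eq_zero (by
    simpa [hb] using congrArg star hby))
  have hfg : f * g = 0 := hβy.2.2 _ (hαx.mul_of_star_mul_eq_zero (by
    simpa using congrArg star hxy))
  have hfs : star f = f := hαx.1.1
  have hgs : star g = g := hβy.1.1
  have hff : f * f = f := hαx.1.2
  have hfe : f * e = 0 := by simpa [hes, hfs] using congrArg star hef
  have heα : e * α = 0 := by rw [← hfα, ← mul_assoc, hef, zero_mul]
  have heβ : e * β = 0 := by rw [← hgβ, ← mul_assoc, heg, zero_mul]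
  have hfβ : f * β = 0 := by rw [← hgβ, ← mul_assoc, hfg, zero_mul]
  have hbα : b * α = 0 := by rw [← hbe, mul_assoc, heα, mul_zero]
  have hbβ : b * β = 0 := by rw [← hbe, mul_assoc, heβ, mul_zero]
  have cut : ∀ p : A, IsProjection p → star (p * a) * (p * a) ≤ b * b := fun p hp => by
    have h1 : star (p * a) * (p * a) + star (a - p * a) * (a - p * a) = b * b := by
      rw [← ha]
      simp only [star_sub, star_mul, hp.1, mul_sub, sub_mul, mul_assoc,
        mul_mul_of_mul_eq hp.2]
      abel
    rw [← h1]
    exact le_add_of_nonneg_right (star_mul_self_nonneg _)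
  have hE : IsProjection (e + f) :=
    ⟨by rw [star_add, hes, hfs], by
      rw [add_mul, mul_add, mul_add, hee, hff, hef, hfe]; abel⟩
  have hcut : star (a - (e + f) * a) * (a - (e + f) * a) ≤ b * b := by
    have h1 : star (a - (e + f) * a) * (a - (e + f) * a)
        + star ((e + f) * a) * ((e + f) * a) = b * b := by
      rw [← ha]
      simp only [star_sub, star_mul, hE.1, mul_sub, sub_mul, mul_assoc,
        mul_mul_of_mul_eq hE.2]
      abel
    rw [← h1]
    exact le_add_of_nonneg_right (star_mul_self_nonneg _)
  obtain ⟨c₁, hc₁⟩ := hA.exists_mul_eq_of_le (a := a - (e + f) * a) (b := b) (v := α) hb hcut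
    (by
      rw [add_mul, mul_sub, mul_add, ← mul_assoc, ← mul_assoc, hbe, ← hbe, mul_assoc b e f, hef]
      simp [hbe])
    (he ▸ hαe.1) (by rw [← he, heb]) hbα
    (by
      rw [star_sub, star_mul, hE.1, sub_mul, mul_assoc, add_mul, heα, hfα, zero_add, sub_self])
  obtain ⟨c₂, hc₂⟩ := hA.exists_mul_eq_of_le (a := f * a) (b := b) (v := β) hb (cut f hαx.1)
    (by rw [← hbe, mul_assoc, ← mul_assoc e, hef, zero_mul, mul_zero])
    (hβe' ▸ hβe.1) (by rw [hβe', heb]) hbβ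
    (by rw [star_mul, hfs, mul_assoc, hfβ, mul_zero])
  have hαα : star α * α = e := he.symm
  have hββ : star β * β = e := hβe'
  have hαf : star α * f = star α := by
    simpa [hfs] using congrArg star hfα
  have hαβ : star α * β = 0 := by
    rw [← hαf, mul_assoc, hfβ, mul_zero]
  have heα' : e * star α = star α := by
    simpa [hes] using congrArg star hαE
  have hvv : star (β * star α) * (β * star α) = f := by
    simp only [star_mul, star_star, mul_assoc, mul_mul_of_mul_eq hββ, heα']
    exact hf.symm
  obtain ⟨c₃, hc₃⟩ := hA.exists_mul_eq_of_le (a := e * a * star α) (b := α * b * star α)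
    (v := β * star α) (by simp [hb, mul_assoc])
    (by
      have h1 := star_left_conjugate_le_conjugate (cut e hαe.1) (star α)
      simp only [star_mul, star_star, mul_assoc, mul_mul_of_mul_eq hαα,
        mul_mul_of_mul_eq heb] at h1 ⊢
      exact h1)
    (by
      have : star α * e = 0 := by simpa [hes] using congrArg star heα
      simp only [mul_assoc, mul_mul_of_mul_eq this, zero_mul, mul_zero])
    (by rw [hvv]; exact hαx.1)
    (by rw [hvv]; simp only [mul_assoc, mul_mul_of_mul_eq hfα])
    (by simp only [mul_assoc, mul_mul_of_mul_eq hαβ, zero_mul, mul_zero])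
    (by simp only [star_mul, star_star, hes, mul_assoc, mul_mul_of_mul_eq heβ, zero_mul,
      mul_zero])
  have hc₃' : c₃ * α * b = e * a := by
    have := congrArg (· * α) hc₃
    simp only [mul_assoc, hαα, hbe, haE] at this
    rw [mul_assoc, this]
  refine ⟨c₁ + c₂ + c₃ * α, ?_⟩
  rw [add_mul, add_mul, hc₁, hc₂, hc₃', add_mul]
  abel

end Ordered

section WeightedSum

variable {A : Type*} [NonUnitalCStarAlgebra A]

/-- The sum `∑ 2⁻ⁿ uₙ`. -/
noncomputable def geomSum (u : ℕ → A) : A := ∑' n, (1 / 2 : ℝ) ^ n • u n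

variable {u : ℕ → A}

theorem summable_geom_smul (hu : ∀ n, ‖u n‖ ≤ 1) :
    Summable fun n => (1 / 2 : ℝ) ^ n • u n := by
  refine Summable.of_norm_bounded summable_geometric_two fun n => ?_
  rw [norm_smul, norm_pow, Real.norm_of_nonneg (by norm_num)]
  exact mul_le_of_le_one_right (by positivity) (hu n)

theorem mul_geomSum (hu : ∀ n, ‖u n‖ ≤ 1) (y : A) :
    y * geomSum u = geomSum fun n => y * u n := by
  rw [geomSum, geomSum, ← (summable_geom_smul hu).tsum_mul_left]
  simp only [mul_smul_comm]

theorem geomSum_mul (hu : ∀ n, ‖u n‖ ≤ 1) (y : A) :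
    geomSum u * y = geomSum fun n => u n * y := by
  rw [geomSum, geomSum, ← (summable_geom_smul hu).tsum_mul_right]
  simp only [smul_mul_assoc]

theorem star_geomSum : star (geomSum u) = geomSum fun n => star (u n) := by
  simp [geomSum, tsum_star]

theorem geomSum_eq_single {m : ℕ} (h : ∀ n, n ≠ m → u n = 0) :
    geomSum u = (1 / 2 : ℝ) ^ m • u m :=
  tsum_eq_single m fun n hn => by rw [h n hn, smul_zero]

theorem geomSum_eq_zero (h : ∀ n, u n = 0) : geomSum u = 0 := by
  simp [geomSum, h]

theorem star_geomSum_mul_geomSum {x : ℕ → A} (hu : ∀ n, ‖u n‖ ≤ 1) (hx : ∀ n, ‖x n‖ ≤ 1)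
    (h : ∀ m n, m ≠ n → star (u m) * x n = 0) :
    star (geomSum u) * geomSum x
      = geomSum fun n => (1 / 2 : ℝ) ^ n • (star (u n) * x n) := by
  rw [mul_geomSum hx]
  congr 1
  funext n
  rw [star_geomSum, geomSum_mul (fun n => by simpa using hu n),
    geomSum_eq_single fun m hm => h m n hm]

theorem eq_of_half_pow_smul_eq {a b : A} {n : ℕ}
    (h : (1 / 2 : ℝ) ^ n • a = (1 / 2 : ℝ) ^ n • b) : a = b :=
  smul_right_injective A (pow_ne_zero n (by norm_num : (1 / 2 : ℝ) ≠ 0)) h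

theorem WeaklyRickart.exists_sup (hA : WeaklyRickart A) {r : ℕ → A}
    (hr : ∀ n, IsProjection (r n)) (ho : ∀ m n, m ≠ n → r m * r n = 0) :
    ∃ e : A, IsProjection e ∧ (∀ n, e * r n = r n) ∧
      ∀ y : A, (∀ n, y * r n = 0) → y * e = 0 := by
  have hn : ∀ n, ‖r n‖ ≤ 1 := fun n => (hr n).norm_le_one
  obtain ⟨e, he⟩ := hA.exists_isALP (geomSum r)
  refine ⟨e, he.1, fun n => ?_, fun y hy => he.2.2 y ?_⟩
  · have h1 : geomSum r * r n = (1 / 2 : ℝ) ^ n • r n := by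
      rw [geomSum_mul hn, geomSum_eq_single fun m hm => ho m n hm, (hr n).2]
    have h2 : e * (geomSum r * r n) = geomSum r * r n := by rw [← mul_assoc, he.2.1]
    rw [h1, mul_smul_comm] at h2
    exact eq_of_half_pow_smul_eq h2
  · rw [mul_geomSum hn, geomSum_eq_zero hy]

end WeightedSum

section Diagonal

variable {A : Type*} [NonUnitalCStarAlgebra A]

theorem WeaklyRickart.exists_sum_projections (hA : WeaklyRickart A) {p y : ℕ → A}
    (hp : ∀ n, IsProjection (p n)) (hpy : ∀ n z, y n * z = 0 → p n * z = 0)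
    (ho : ∀ m n, m ≠ n → p m * p n = 0) :
    ∃ P : A, ‖P‖ ≤ 1 ∧
      ∀ n z, (∀ m, m ≠ n → y m * z = 0) → P * z = p n * z := by
  obtain ⟨P, hP, h1, h2⟩ := hA.exists_sup hp ho
  refine ⟨P, hP.norm_le_one, fun n z hz => ?_⟩
  have h3 : ∀ m, p m * P = p m := fun m => by
    simpa [hP.1, (hp m).1] using congrArg star (h1 m)
  have h4 : ∀ m, star (P * z - p n * z) * p m = 0 := fun m => by
    have : p m * (P * z - p n * z) = 0 := by
      rw [mul_sub, ← mul_assoc, h3, ← mul_assoc]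
      rcases eq_or_ne m n with rfl | hm
      · rw [(hp m).2, sub_self]
      · rw [ho m n hm, zero_mul, sub_zero, hpy m z (hz m hm)]
    simpa [(hp m).1] using congrArg star this
  have h5 := congrArg star (h2 _ h4)
  rw [star_mul, star_star, star_zero, hP.1, mul_sub, ← mul_assoc, ← mul_assoc, hP.2, h1,
    sub_eq_zero] at h5
  exact h5

variable [PartialOrder A] [StarOrderedRing A]

theorem mul_self_le_self_of_norm_le_one {k : A} (hk : 0 ≤ k) (h1 : ‖k‖ ≤ 1) : k * k ≤ k := by
  have hs : star (CFC.sqrt k) = CFC.sqrt k := (CFC.sqrt_nonneg k).isSelfAdjoint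
  have hq := CFC.sqrt_mul_sqrt_self k hk
  have h2 := CStarAlgebra.star_left_conjugate_le_norm_smul (a := CFC.sqrt k) (b := k)
    hk.isSelfAdjoint
  have h3 : CFC.sqrt k * k * CFC.sqrt k = k * k := by
    nth_rewrite 2 [← hq]
    rw [← mul_assoc, hq, mul_assoc, hq]
  rw [hs, hq, h3] at h2
  refine h2.trans ?_
  have h4 : 0 ≤ (1 - ‖k‖) • k := smul_nonneg (by linarith) hk
  rwa [sub_smul, one_smul, sub_nonneg] at h4

/-- Half the sign of a self-adjoint contraction approximates it to within one half. -/
theorem WeaklyRickart.exists_sign (hA : WeaklyRickart A) {y : A} (hy : star y = y)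
    (h1 : ‖y‖ ≤ 1) :
    ∃ p q : A, IsProjection p ∧ IsProjection q ∧ (∀ z, y * z = 0 → p * z = 0) ∧
      (∀ z, y * z = 0 → q * z = 0) ∧ ‖(2 : ℝ) • y - (p - q)‖ ≤ 1 := by
  obtain ⟨c, hc⟩ : ∃ c, c = y⁺ := ⟨_, rfl⟩
  obtain ⟨d, hd⟩ : ∃ d, d = y⁻ := ⟨_, rfl⟩
  have hc0 : 0 ≤ c := hc ▸ CFC.posPart_nonneg y
  have hd0 : 0 ≤ d := hd ▸ CFC.negPart_nonneg y
  have hcd : c * d = 0 := by rw [hc, hd, CFC.posPart_mul_negPart]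
  have hdc : d * c = 0 := by rw [hc, hd, CFC.negPart_mul_posPart]
  have hycd : y = c - d := by rw [hc, hd, CFC.posPart_sub_negPart y hy]
  have hcs : star c = c := hc0.isSelfAdjoint
  have hds : star d = d := hd0.isSelfAdjoint
  obtain ⟨p, hp⟩ := hA.exists_isALP c
  obtain ⟨q, hq⟩ := hA.exists_isALP d
  have hps := hp.1.1
  have hqs := hq.1.1
  have hpc : p * c = c := hp.2.1
  have hqd : q * d = d := hq.2.1
  have hcp : c * p = c := by simpa [hps, hcs] using congrArg star hpc
  have hdq : d * q = d := by simpa [hqs, hds] using congrArg star hqd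
  have hpd : p * d = 0 := hp.mul_of_star_mul_eq_zero (by rw [hds, hdc])
  have hqc : q * c = 0 := hq.mul_of_star_mul_eq_zero (by rw [hcs, hcd])
  have hdp : d * p = 0 := by simpa [hps, hds] using congrArg star hpd
  have hcq : c * q = 0 := by simpa [hqs, hcs] using congrArg star hqc
  have hpq : p * q = 0 := hq.2.2 _ hpd
  have hqp : q * p = 0 := hp.2.2 _ hqc
  have hkk : (c + d) * (c + d) = y * y := by
    rw [hycd]; simp only [mul_add, add_mul, mul_sub, sub_mul, hcd, hdc]; abel
  have hk0 : 0 ≤ c + d := add_nonneg hc0 hd0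
  have hk1 : ‖c + d‖ ≤ 1 := by
    have h2 : ‖c + d‖ * ‖c + d‖ = ‖y‖ * ‖y‖ := by
      rw [← CStarRing.norm_star_mul_self, ← CStarRing.norm_star_mul_self, hy, star_add, hcs,
        hds, hkk]
    nlinarith [norm_nonneg y, norm_nonneg (c + d)]
  have hle := mul_self_le_self_of_norm_le_one hk0 hk1
  have hpqP : IsProjection (p + q) :=
    ⟨by rw [star_add, hps, hqs], by
      rw [add_mul, mul_add, mul_add, hp.1.2, hq.1.2, hpq, hqp]; abel⟩
  refine ⟨p, q, hp.1, hq.1, fun z hz => ?_, fun z hz => ?_, ?_⟩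
  · refine hp.mul_of_star_mul_eq_zero ?_
    have h2 : c * (c * z) = 0 := by
      have : c * (y * z) = c * (c * z) := by
        rw [hycd, sub_mul, mul_sub, mul_mul_of_mul_eq hcd, zero_mul, sub_zero]
      rw [← this, hz, mul_zero]
    have h3 : star (c * z) * (c * z) = 0 := by
      rw [star_mul, hcs, mul_assoc, h2, mul_zero]
    simpa [hcs] using congrArg star ((CStarRing.star_mul_self_eq_zero_iff _).mp h3)
  · refine hq.mul_of_star_mul_eq_zero ?_
    have h2 : d * (d * z) = 0 := by
      have : d * (y * z) = - (d * (d * z)) := by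
        rw [hycd, sub_mul, mul_sub, mul_mul_of_mul_eq hdc, zero_mul, zero_sub]
      rw [← neg_eq_zero, ← this, hz, mul_zero]
    have h3 : star (d * z) * (d * z) = 0 := by
      rw [star_mul, hds, mul_assoc, h2, mul_zero]
    simpa [hds] using congrArg star ((CStarRing.star_mul_self_eq_zero_iff _).mp h3)
  · have hX : star ((2 : ℝ) • y - (p - q)) * ((2 : ℝ) • y - (p - q))
        = (p + q) - (4 : ℝ) • ((c + d) - (c + d) * (c + d)) := by
      rw [star_sub, star_smul, hy, star_sub, hps, hqs, hycd]
      simp only [star_trivial, mul_sub, sub_mul, mul_add, add_mul, smul_mul_assoc,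
        mul_smul_comm, hcd, hdc, hpc, hqd, hcp, hdq, hpd, hqc, hdp, hcq, hpq, hqp, hp.1.2,
        hq.1.2]
      module
    have hXle : star ((2 : ℝ) • y - (p - q)) * ((2 : ℝ) • y - (p - q)) ≤ p + q := by
      rw [hX]
      exact sub_le_self _ (smul_nonneg (by norm_num) (sub_nonneg.mpr hle))
    have h2 := (CStarAlgebra.norm_le_norm_of_nonneg_of_le (star_mul_self_nonneg _) hXle).trans
      hpqP.norm_le_one
    rw [CStarRing.norm_star_mul_self] at h2
    nlinarith [norm_nonneg ((2 : ℝ) • y - (p - q))]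

end Diagonal

section DiagonalSum

variable {A : Type*} [NonUnitalCStarAlgebra A]

/-- A family of pairwise orthogonal self-adjoint contractions. -/
def IsDiagonal (y : ℕ → A) : Prop :=
  (∀ n, star (y n) = y n) ∧ (∀ n, ‖y n‖ ≤ 1) ∧ ∀ m n, m ≠ n → y m * y n = 0

variable [PartialOrder A] [StarOrderedRing A]

theorem WeaklyRickart.exists_halving (hA : WeaklyRickart A) {y : ℕ → A} (hy : IsDiagonal y) :
    ∃ (S : A) (y' : ℕ → A), ‖S‖ ≤ 2 ∧ IsDiagonal y' ∧ (∀ n z, y n * z = 0 → y' n * z = 0) ∧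
      ∀ n z, (∀ m, m ≠ n → y m * z = 0) → S * z = (2 : ℝ) • (y n * z) - y' n * z := by
  obtain ⟨hs, h1, ho⟩ := hy
  choose p q hp hq hpy hqy hpq using fun n => hA.exists_sign (hs n) (h1 n)
  have orth : ∀ {r s : ℕ → A}, (∀ n, star (r n) = r n) → (∀ n z, y n * z = 0 → r n * z = 0) →
      (∀ n z, y n * z = 0 → s n * z = 0) → ∀ m n, m ≠ n → s m * r n = 0 := by
    intro r s hr hry hsy m n hmn
    refine hsy m _ ?_
    have h2 := congrArg star (hry n _ (ho n m hmn.symm))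
    rwa [star_mul, hr, hs, star_zero] at h2
  have hps := fun n => (hp n).1
  have hqs := fun n => (hq n).1
  obtain ⟨P, hP, hPz⟩ := hA.exists_sum_projections hp hpy (orth hps hpy hpy)
  obtain ⟨Q, hQ, hQz⟩ := hA.exists_sum_projections hq hqy (orth hqs hqy hqy)
  have hker : ∀ n z, y n * z = 0 → ((2 : ℝ) • y n - (p n - q n)) * z = 0 := fun n z hz => by
    rw [sub_mul, smul_mul_assoc, hz, sub_mul, hpy n z hz, hqy n z hz]; simp
  have hsa : ∀ n, star ((2 : ℝ) • y n - (p n - q n)) = (2 : ℝ) • y n - (p n - q n) := fun n => by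
    simp [hs, hps, hqs]
  refine ⟨P - Q, fun n => (2 : ℝ) • y n - (p n - q n), ?_, ⟨hsa, hpq, orth hsa hker hker⟩, hker,
    fun n z hz => ?_⟩
  · exact (norm_sub_le _ _).trans (by linarith)
  · rw [sub_mul, hPz n z hz, hQz n z hz, sub_mul, sub_mul, smul_mul_assoc]; abel

/-- Pairwise orthogonal self-adjoint contractions are the diagonal entries of an element. -/
theorem WeaklyRickart.exists_diagonal_sum (hA : WeaklyRickart A) {y : ℕ → A}
    (hy : IsDiagonal y) :
    ∃ Y : A, ∀ n z, (∀ m, m ≠ n → y m * z = 0) → Y * z = y n * z := by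
  choose S y' hS hy' hker hSz using fun y : {y : ℕ → A // IsDiagonal y} => hA.exists_halving y.2
  obtain ⟨F, hF0, hF⟩ : ∃ F : ℕ → {y : ℕ → A // IsDiagonal y},
      F 0 = ⟨y, hy⟩ ∧ ∀ k, F (k + 1) = ⟨y' (F k), hy' (F k)⟩ :=
    ⟨fun k => Nat.rec ⟨y, hy⟩ (fun _ G => ⟨y' G, hy' G⟩) k, rfl, fun _ => rfl⟩
  have hT : ∀ k, ‖(1 / 2 : ℝ) • S (F k)‖ ≤ 1 := fun k => by
    rw [norm_smul, Real.norm_of_nonneg (by norm_num)]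
    linarith [hS (F k)]
  refine ⟨geomSum fun k => (1 / 2 : ℝ) • S (F k), fun n z hz => ?_⟩
  have hzk : ∀ k m, m ≠ n → (F k).1 m * z = 0 := by
    intro k
    induction k with
    | zero => rw [hF0]; exact hz
    | succ k ih => rw [hF]; exact fun m hm => hker _ _ _ (ih m hm)
  have hstep : ∀ k, (1 / 2 : ℝ) ^ k • ((1 / 2 : ℝ) • S (F k) * z)
      = (1 / 2 : ℝ) ^ k • ((F k).1 n * z) - (1 / 2 : ℝ) ^ (k + 1) • ((F (k + 1)).1 n * z) := by
    intro k
    rw [smul_mul_assoc, hSz _ n z (hzk k), hF]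
    simp only [pow_succ]
    module
  have hsum := ((summable_geom_smul hT).mul_right z).hasSum.tendsto_sum_nat
  rw [(summable_geom_smul hT).tsum_mul_right] at hsum
  simp only [smul_mul_assoc (_ ^ _ : ℝ), hstep] at hsum
  have hlim : Filter.Tendsto (fun k => (1 / 2 : ℝ) ^ k • ((F k).1 n * z)) Filter.atTop
      (nhds 0) := by
    refine squeeze_zero_norm (a := fun k => (1 / 2 : ℝ) ^ k * ‖z‖) (fun k => ?_) ?_
    · rw [norm_smul, norm_pow, Real.norm_of_nonneg (by norm_num : (0 : ℝ) ≤ 1 / 2)]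
      refine mul_le_mul_of_nonneg_left ((norm_mul_le _ _).trans ?_) (by positivity)
      exact mul_le_of_le_one_left (norm_nonneg z) ((F k).2.2.1 n)
    · simpa using (tendsto_pow_atTop_nhds_zero_of_lt_one (by norm_num : (0 : ℝ) ≤ 1 / 2)
        (by norm_num)).mul_const ‖z‖
  refine tendsto_nhds_unique hsum ?_
  simp only [Finset.sum_range_sub', pow_zero, one_smul, hF0]
  simpa using tendsto_const_nhds.sub hlim

end DiagonalSum

section Families

variable {A : Type*} [NonUnitalCStarAlgebra A]

/-- A sequence of partial isometries with pairwise orthogonal initial projections and pairwise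
orthogonal final projections. -/
structure IsOrthoFamily (u : ℕ → A) : Prop where
  proj : ∀ n, IsProjection (star (u n) * u n)
  left : ∀ m n, m ≠ n → star (u m) * u n = 0
  right : ∀ m n, m ≠ n → u m * star (u n) = 0

/-- A sequence of partial isometries which can be added up inside the algebra. -/
def IsAddable (u : ℕ → A) : Prop := ∃ W : A, ∀ n, W * (star (u n) * u n) = u n

/-- `x` is a sequence with the same initial projections as `u`, with pairwise orthogonal final
projections, which are also orthogonal to all the initial projections. -/
structure IsCopy (u x : ℕ → A) : Prop where
  eq : ∀ n, star (x n) * x n = star (u n) * u n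
  left : ∀ m n, m ≠ n → star (x m) * x n = 0
  mul : ∀ m n, u m * x n = 0

variable {u x y : ℕ → A}

namespace IsOrthoFamily

theorem norm_le_one (hu : IsOrthoFamily u) (n : ℕ) : ‖u n‖ ≤ 1 :=
  norm_le_one_of_isProjection_star_mul_self (hu.proj n)

theorem mul_initial (hu : IsOrthoFamily u) (n : ℕ) : u n * (star (u n) * u n) = u n :=
  mul_star_self_mul_of_isProjection (hu.proj n)

theorem mul_initial_of_ne (hu : IsOrthoFamily u) {m n : ℕ} (h : m ≠ n) :
    u m * (star (u n) * u n) = 0 := by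
  rw [← mul_assoc, hu.right m n h, zero_mul]

theorem initial_mul_initial (hu : IsOrthoFamily u) {m n : ℕ} (h : m ≠ n) :
    star (u m) * u m * (star (u n) * u n) = 0 := by
  rw [mul_assoc, hu.mul_initial_of_ne h, mul_zero]

end IsOrthoFamily

theorem IsCopy.norm_le_one (hx : IsCopy u x) (hu : IsOrthoFamily u) (n : ℕ) : ‖x n‖ ≤ 1 :=
  norm_le_one_of_isProjection_star_mul_self (hx.eq n ▸ hu.proj n)

variable [PartialOrder A] [StarOrderedRing A]

theorem IsOrthoFamily.isAddable_of_mul_eq_zero (hA : WeaklyRickart A) (hu : IsOrthoFamily u)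
    (h : ∀ m n, m ≠ n → u m * u n = 0) : IsAddable u := by
  have h' : ∀ m n, m ≠ n → star (u m) * star (u n) = 0 := fun m n hmn => by
    rw [← star_mul, h n m hmn.symm, star_zero]
  have hn := hu.norm_le_one
  have hn' : ∀ n, ‖star (u n)‖ ≤ 1 := fun n => by simpa using hn n
  obtain ⟨Y, hY⟩ := hA.exists_diagonal_sum (y := fun n => (1 / 2 : ℂ) • (u n + star (u n)))
    ⟨fun n => by simp [add_comm], fun n => by
      rw [norm_smul]
      have := norm_add_le (u n) (star (u n))
      norm_num
      linarith [hn n, hn' n], fun m n hmn => by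
      simp [smul_mul_assoc, mul_smul_comm, add_mul, mul_add, h m n hmn, h' m n hmn,
        hu.left m n hmn, hu.right m n hmn]⟩
  obtain ⟨Z, hZ⟩ := hA.exists_diagonal_sum
    (y := fun n => (Complex.I / 2 : ℂ) • (star (u n) - u n))
    ⟨fun n => by
      have : star (Complex.I / 2 : ℂ) = - (Complex.I / 2) := by simp; ring
      rw [star_smul, this, star_sub, star_star]; module, fun n => by
      rw [norm_smul]
      have := norm_sub_le (star (u n)) (u n)
      norm_num
      linarith [hn n, hn' n], fun m n hmn => by
      simp [smul_mul_assoc, mul_smul_comm, sub_mul, mul_sub, h m n hmn, h' m n hmn,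
        hu.left m n hmn, hu.right m n hmn]⟩
  have key : ∀ m n, m ≠ n → star (u m) * (star (u n) * u n) = 0 := fun m n hmn => by
    rw [← mul_assoc, h' m n hmn, zero_mul]
  refine ⟨Y + Complex.I • Z, fun n => ?_⟩
  rw [add_mul, smul_mul_assoc,
    hY n _ fun m hm => by simp [smul_mul_assoc, add_mul, hu.mul_initial_of_ne hm, key m n hm],
    hZ n _ fun m hm => by simp [smul_mul_assoc, sub_mul, hu.mul_initial_of_ne hm, key m n hm]]
  rw [smul_mul_assoc, smul_mul_assoc, add_mul, sub_mul, hu.mul_initial, smul_smul,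
    ← mul_div_assoc, Complex.I_mul_I]
  module

theorem IsOrthoFamily.isAddable_of_two_copies (hA : WeaklyRickart A) (hu : IsOrthoFamily u)
    (hx : IsCopy u x) (hy : IsCopy u y) (hxy : ∀ m n, star (x m) * y n = 0) : IsAddable u := by
  obtain ⟨d, hd⟩ : ∃ d : ℕ → A, d = fun n => star (u n) * u n := ⟨_, rfl⟩
  have hdn : ∀ n, star (u n) * u n = d n := fun n => by rw [hd]
  have hdP : ∀ n, IsProjection (d n) := fun n => hdn n ▸ hu.proj n
  have hd1 : ∀ n, ‖d n‖ ≤ 1 := fun n => (hdP n).norm_le_one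
  have hdo : ∀ m n, m ≠ n → d m * d n = 0 := fun m n hmn => by
    rw [← hdn, ← hdn, hu.initial_mul_initial hmn]
  have hu1 := hu.norm_le_one
  have hds : star (geomSum d) = geomSum d := by
    rw [star_geomSum]; congr 1; funext n; exact (hdP n).1
  have hdd : geomSum d * geomSum d = geomSum fun n => (1 / 2 : ℝ) ^ n • d n := by
    have := star_geomSum_mul_geomSum hd1 hd1 fun m n hmn => by rw [(hdP m).1, hdo m n hmn]
    rw [hds] at this
    rw [this]; congr 1; funext n; rw [(hdP n).1, (hdP n).2]
  have hsq : ∀ {v : ℕ → A}, (∀ n, ‖v n‖ ≤ 1) → (∀ m n, m ≠ n → star (v m) * v n = 0) →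
      (∀ n, star (v n) * v n = d n) →
      star (geomSum v) * geomSum v = geomSum d * geomSum d := fun hv1 hvo hvd => by
    rw [star_geomSum_mul_geomSum hv1 hv1 hvo, hdd]; congr 1; funext n; rw [hvd]
  have hdx : ∀ {v : ℕ → A}, IsCopy u v → geomSum d * geomSum v = 0 := fun hv => by
    rw [mul_geomSum (hv.norm_le_one hu)]
    refine geomSum_eq_zero fun n => ?_
    rw [geomSum_mul hd1]
    exact geomSum_eq_zero fun m => by rw [← hdn, mul_assoc, hv.mul, mul_zero]
  obtain ⟨W, hW⟩ := hA.exists_mul_eq_of_copies (a := geomSum u) hds (hsq hu1 hu.left hdn)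
    (hsq (hx.norm_le_one hu) hx.left fun n => (hx.eq n).trans (hdn n))
    (hsq (hy.norm_le_one hu) hy.left fun n => (hy.eq n).trans (hdn n)) (hdx hx) (hdx hy) (by
      rw [mul_geomSum (hy.norm_le_one hu)]
      refine geomSum_eq_zero fun n => ?_
      rw [star_geomSum, geomSum_mul fun n => by simpa using hx.norm_le_one hu n]
      exact geomSum_eq_zero fun m => hxy m n)
  refine ⟨W, fun n => ?_⟩
  have h1 := congrArg (· * d n) hW
  rw [mul_assoc, geomSum_mul hd1, geomSum_mul hu1, geomSum_eq_single fun m hm => hdo m n hm,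
    geomSum_eq_single fun m hm => by rw [← hdn, hu.mul_initial_of_ne hm], mul_smul_comm] at h1
  have h2 := eq_of_half_pow_smul_eq h1
  rwa [(hdP n).2, ← hdn, hu.mul_initial] at h2

end Families

section Splitting

variable {A : Type*} [NonUnitalCStarAlgebra A]

/-- Partial isometries `v k` from a part of `d (j k)` onto a part of `d (i k)`, with all the
initial and final projections pairwise orthogonal. -/
structure IsTransfer (d : ℕ → A) (i j : ℕ → ℕ) (v : ℕ → A) : Prop where
  partial_isometry : ∀ k, v k * (star (v k) * v k) = v k
  mul_right : ∀ k, v k * d (j k) = v k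
  mul_left : ∀ k, d (i k) * v k = v k
  mul_star : ∀ k l, k ≠ l → v k * star (v l) = 0
  star_mul : ∀ k l, k ≠ l → star (v k) * v l = 0
  mul : ∀ k l, v k * v l = 0

/-- A decomposition of pairwise orthogonal projections `d n` relative to elements `u n`: a transfer
`v` between parts of the `d n`, and remainders `t n` with respect to which the `u n` have no
off-diagonal entries. -/
structure IsSplitting (d u : ℕ → A) (i j : ℕ → ℕ) (v t : ℕ → A) : Prop
    extends IsTransfer d i j v where
  proj : ∀ n, IsProjection (t n)
  mul_rem : ∀ n, d n * t n = t n
  rem_mul_mul_rem : ∀ m n, m ≠ n → t m * u n * t n = 0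
  rem_mul : ∀ n k, t n * v k = 0
  mul_rem_eq_zero : ∀ k n, v k * t n = 0
  complete : ∀ n y, y * t n = 0 → (∀ k, y * v k = 0) → (∀ k, y * star (v k) = 0) → y * d n = 0

variable [PartialOrder A] [StarOrderedRing A] {d : ℕ → A}

theorem WeaklyRickart.exists_splitting_step (hA : WeaklyRickart A)
    (hd : ∀ n, IsProjection (d n)) (ho : ∀ m n, m ≠ n → d m * d n = 0) (w : A) {s : A}
    (hs : IsProjection s) (hsd : ∀ n, s * d n = d n * s) (i j : ℕ) :
    ∃ v : A, v * (star v * v) = v ∧ v * d j = v ∧ d i * v = v ∧ v * s = 0 ∧ s * v = 0 ∧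
      v * v = 0 ∧ (i ≠ j →
        v * star v * ((d i - s * d i) * w * (d j - s * d j))
          = (d i - s * d i) * w * (d j - s * d j)) := by
  rcases eq_or_ne i j with hij | hij
  · exact ⟨0, by simp, by simp, by simp, by simp, by simp, by simp, fun h => absurd hij h⟩
  obtain ⟨x, hx⟩ : ∃ x, x = (d i - s * d i) * w * (d j - s * d j) := ⟨_, rfl⟩
  have hr : ∀ n, (d n - s * d n) * d n = d n - s * d n := fun n => by
    rw [sub_mul, mul_assoc, (hd n).2]
  have hl : ∀ n, d n * (d n - s * d n) = d n - s * d n := fun n => by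
    rw [hsd, mul_sub, ← mul_assoc, (hd n).2]
  have hsl : ∀ n, s * (d n - s * d n) = 0 := fun n => by
    rw [mul_sub, ← mul_assoc, hs.2, sub_self]
  have hsr : ∀ n, (d n - s * d n) * s = 0 := fun n => by
    rw [hsd, sub_mul, mul_assoc, hs.2, sub_self]
  have hxd : x * d j = x := by rw [hx, mul_assoc, hr]
  have hdx : d i * x = x := by rw [hx, ← mul_assoc, ← mul_assoc, hl]
  have hsx : s * x = 0 := by rw [hx, ← mul_assoc, ← mul_assoc, hsl, zero_mul, zero_mul]
  have hxs : x * s = 0 := by rw [hx, mul_assoc, hsr, mul_zero]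
  have hxx : x * x = 0 := by
    calc x * x = x * d j * (d i * x) := by rw [hxd, hdx]
      _ = 0 := by rw [mul_assoc, mul_mul_of_mul_eq (ho j i hij.symm), zero_mul, mul_zero]
  obtain ⟨b, hb⟩ : ∃ b, b = CFC.sqrt (star x * x) := ⟨_, rfl⟩
  have hbs : star b = b := hb ▸ (CFC.sqrt_nonneg (star x * x)).isSelfAdjoint
  have hbb : star b * b = star x * x := by
    rw [hbs, hb, CFC.sqrt_mul_sqrt_self _ (star_mul_self_nonneg x)]
  obtain ⟨v, -, hvb, hvx⟩ := hA.exists_mul_eq_of_star_mul_eq_zero (a := x) (b := b) hbb.symm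
    (by rw [hbs]; exact mul_eq_zero_of_star_mul_self_le hbb.le hxx)
  have hv := mul_star_self_mul_of_isProjection hvb.1
  have hvd : v * d j = v := by
    have h1 : b * d j = b := mul_eq_of_star_mul_self_le (hd j) hbb.le hxd
    have h2 : d j * b = b := by simpa [hbs, (hd j).1] using congrArg star h1
    have h3 := congrArg star (hvb.mul_mul_eq h2)
    rw [star_mul, hvb.1.1, (hd j).1] at h3
    rw [← hv, mul_assoc, h3]
  have hdv : d i * v = v := by
    have h1 := hvx.mul_mul_eq hdx
    rw [← hv, ← mul_assoc v, ← mul_assoc, h1]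
  refine ⟨v, hv, hvd, hdv, ?_, ?_, ?_, fun _ => hx ▸ hvx.2.1⟩
  · have h1 : b * s = 0 := mul_eq_zero_of_star_mul_self_le hbb.le hxs
    have h2 : s * b = 0 := by simpa [hbs, hs.1] using congrArg star h1
    have h3 := congrArg star (hvb.2.2 _ h2)
    rw [star_mul, hvb.1.1, hs.1, star_zero] at h3
    rw [← hv, mul_assoc, h3, mul_zero]
  · rw [← hv, ← mul_assoc v, ← mul_assoc, hvx.2.2 _ hsx, zero_mul]
  · calc v * v = v * d j * (d i * v) := by rw [hvd, hdv]
      _ = 0 := by rw [mul_assoc, mul_mul_of_mul_eq (ho j i hij.symm), zero_mul, mul_zero]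

theorem WeaklyRickart.exists_splitting (hA : WeaklyRickart A)
    (hd : ∀ n, IsProjection (d n)) (ho : ∀ m n, m ≠ n → d m * d n = 0) (u : ℕ → A) :
    ∃ i j v t, IsSplitting d u i j v t := by
  let T := {s : A // IsProjection s ∧ ∀ n, s * d n = d n * s}
  choose V hV hVd hdV hVs hsV hVV hVx using fun (s : T) (k : ℕ) =>
    hA.exists_splitting_step hd ho (u k.unpair.2) s.2.1 s.2.2 k.unpair.1 k.unpair.2
  have hVd' : ∀ s k n, V s k * d n = if n = k.unpair.2 then V s k else 0 := fun s k n => by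
    split_ifs with h
    · rw [h, hVd]
    · rw [← hVd, mul_assoc, ho _ _ (Ne.symm h), mul_zero]
  have hdV' : ∀ s k n, d n * V s k = if n = k.unpair.1 then V s k else 0 := fun s k n => by
    split_ifs with h
    · rw [h, hdV]
    · rw [← hdV, ← mul_assoc, ho _ _ h, zero_mul]
  have hstep : ∀ (s : T) k, IsProjection (s.1 + (star (V s k) * V s k + V s k * star (V s k))) ∧
      ∀ n, (s.1 + (star (V s k) * V s k + V s k * star (V s k))) * d n
        = d n * (s.1 + (star (V s k) * V s k + V s k * star (V s k))) := by
    intro s k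
    have e1 := hV s k
    have e2 := hVs s k
    have e3 := hsV s k
    have e4 := hVV s k
    have f1 : star (V s k) * (V s k * star (V s k)) = star (V s k) := by
      simpa [mul_assoc] using congrArg star e1
    have f2 : s.1 * star (V s k) = 0 := by simpa [s.2.1.1] using congrArg star e2
    have f3 : star (V s k) * s.1 = 0 := by simpa [s.2.1.1] using congrArg star e3
    have f4 : star (V s k) * star (V s k) = 0 := by simpa using congrArg star e4
    refine ⟨⟨?_, ?_⟩, fun n => ?_⟩
    · simp [s.2.1.1]
    · simp only [mul_add, add_mul, mul_assoc, s.2.1.2, e1, e2, f1, f3,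
        mul_mul_of_mul_eq e3, mul_mul_of_mul_eq e4, mul_mul_of_mul_eq f2, mul_mul_of_mul_eq f4,
        mul_zero, zero_mul, add_zero, zero_add]
    · have g1 : d n * star (V s k) = if n = k.unpair.2 then star (V s k) else 0 := by
        have := congrArg star (hVd' s k n)
        rw [star_mul, (hd n).1] at this
        rw [this]; split_ifs <;> simp
      have g2 : star (V s k) * d n = if n = k.unpair.1 then star (V s k) else 0 := by
        have := congrArg star (hdV' s k n)
        rw [star_mul, (hd n).1] at this
        rw [this]; split_ifs <;> simp
      simp only [mul_add, add_mul, s.2.2 n, mul_assoc, hVd', g2, mul_mul_of_mul_eq g1,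
        mul_mul_of_mul_eq (hdV' s k n)]
      split_ifs <;> simp
  obtain ⟨F, hF0, hF⟩ : ∃ F : ℕ → T, (F 0).1 = 0 ∧ ∀ k, (F (k + 1)).1
      = (F k).1 + (star (V (F k) k) * V (F k) k + V (F k) k * star (V (F k) k)) :=
    ⟨fun k => Nat.rec ⟨0, isProjection_zero, fun n => by simp⟩
      (fun k s => ⟨_, hstep s k⟩) k, rfl, fun _ => rfl⟩
  obtain ⟨s, hs⟩ : ∃ s : ℕ → A, s = fun k => (F k).1 := ⟨_, rfl⟩
  obtain ⟨v, hv⟩ : ∃ v : ℕ → A, v = fun k => V (F k) k := ⟨_, rfl⟩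
  obtain ⟨c, hc⟩ : ∃ c : ℕ → A, c = fun k => star (v k) * v k + v k * star (v k) := ⟨_, rfl⟩
  have hsP : ∀ k, IsProjection (s k) := fun k => hs ▸ (F k).2.1
  have hsd : ∀ k n, s k * d n = d n * s k := fun k => hs ▸ (F k).2.2
  have hs0 : s 0 = 0 := by rw [hs]; exact hF0
  have hs1 : ∀ k, s (k + 1) = s k + c k := fun k => by simp only [hs, hc, hv, hF]
  have h1 : ∀ k, v k * (star (v k) * v k) = v k := fun k => by rw [hv]; exact hV _ _
  have h2 : ∀ k, v k * s k = 0 := fun k => by rw [hv, hs]; exact hVs _ _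
  have h3 : ∀ k, s k * v k = 0 := fun k => by rw [hv, hs]; exact hsV _ _
  have h4 : ∀ k, v k * v k = 0 := fun k => by rw [hv]; exact hVV _ _
  have h1' : ∀ k, star (v k) * (v k * star (v k)) = star (v k) := fun k => by
    simpa [mul_assoc] using congrArg star (h1 k)
  have h3' : ∀ k, star (v k) * s k = 0 := fun k => by
    simpa [(hsP k).1] using congrArg star (h3 k)
  have h4' : ∀ k, star (v k) * star (v k) = 0 := fun k => by
    simpa using congrArg star (h4 k)
  have hcv : ∀ k, c k * v k = v k := fun k => by
    simp only [hc, add_mul, mul_assoc, h4, h1, mul_zero, zero_add]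
  have hcs : ∀ k, c k * s k = 0 := fun k => by
    simp only [hc, add_mul, mul_assoc, h2, h3', mul_zero, zero_add]
  have hcstar : ∀ k, star (c k) = c k := fun k => by simp [hc]
  have hcd : ∀ k n, c k * d n = d n * c k := fun k n => by
    have e := hsd (k + 1) n
    rwa [hs1, add_mul, mul_add, hsd, add_right_inj] at e
  have hsv : ∀ k l, l < k → s k * v l = v l := fun k l => by
    induction k with
    | zero => exact fun h => absurd h (Nat.not_lt_zero l)
    | succ k ih =>
      intro h
      rw [hs1, add_mul]
      rcases (Nat.lt_succ_iff_lt_or_eq.mp h) with h | rfl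
      · rw [ih h, ← ih h, ← mul_assoc (c k), hcs, zero_mul, add_zero]
      · rw [h3, hcv, zero_add]
  have hvs : ∀ k l, l < k → v l * s k = v l := fun k l => by
    induction k with
    | zero => exact fun h => absurd h (Nat.not_lt_zero l)
    | succ k ih =>
      intro h
      rw [hs1, mul_add]
      rcases (Nat.lt_succ_iff_lt_or_eq.mp h) with h | rfl
      · have : s k * c k = 0 := by
          simpa [hcstar, (hsP k).1] using congrArg star (hcs k)
        rw [ih h, ← ih h, mul_assoc, this, mul_zero, add_zero]
      · rw [h2, hc, mul_add, h1, ← mul_assoc, h4, zero_mul, zero_add, add_zero]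
  have hvs' : ∀ k l, l < k → s k * star (v l) = star (v l) := fun k l h => by
    simpa [(hsP k).1] using congrArg star (hvs k l h)
  have hvv : ∀ k l, v k * v l = 0 := fun k l => by
    rcases lt_trichotomy k l with h | rfl | h
    · rw [← hvs l k h, mul_assoc, h3, mul_zero]
    · exact h4 k
    · rw [← hsv k l h, ← mul_assoc, h2, zero_mul]
  have hvl : ∀ k l, l < k → v k * star (v l) = 0 := fun k l h => by
    rw [← hvs' k l h, ← mul_assoc, h2, zero_mul]
  have hlv : ∀ k l, l < k → star (v k) * v l = 0 := fun k l h => by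
    rw [← hsv k l h, ← mul_assoc, h3', zero_mul]
  have hvstar : ∀ k l, k ≠ l → v k * star (v l) = 0 := fun k l h => by
    rcases h.lt_or_gt with h | h
    · simpa using congrArg star (hvl l k h)
    · exact hvl k l h
  have hstarv : ∀ k l, k ≠ l → star (v k) * v l = 0 := fun k l h => by
    rcases h.lt_or_gt with h | h
    · simpa using congrArg star (hlv l k h)
    · exact hlv k l h
  have hcP : ∀ k, IsProjection (c k) := fun k => ⟨hcstar k, by
    have e : c k * star (v k) = star (v k) := by
      simp only [hc, add_mul, mul_assoc, h4', h1', mul_zero, add_zero]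
    have e' : c k * (star (v k) * v k + v k * star (v k))
        = star (v k) * v k + v k * star (v k) := by
      rw [mul_add, ← mul_assoc, ← mul_assoc, e, hcv]
    simpa only [hc] using e'⟩
  have hcc : ∀ k l, k ≠ l → c k * c l = 0 := fun k l h => by
    have f4 : ∀ k l, star (v k) * star (v l) = 0 := fun k l => by
      simpa using congrArg star (hvv l k)
    simp only [hc, mul_add, add_mul, mul_assoc, mul_mul_of_mul_eq (hvv k l),
      mul_mul_of_mul_eq (hvstar k l h), mul_mul_of_mul_eq (hstarv k l h),
      mul_mul_of_mul_eq (f4 k l), zero_mul, mul_zero, add_zero]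
  obtain ⟨S, hS, hSc, hcS⟩ := hA.exists_sup hcP hcc
  have hSv : ∀ k, S * v k = v k := fun k => by rw [← hcv, ← mul_assoc, hSc]
  have hcSr : ∀ k, c k * S = c k := fun k => by
    simpa [hS.1, hcstar] using congrArg star (hSc k)
  have hvS : ∀ k, v k * S = v k := fun k => by
    have e : v k * c k = v k := by
      rw [hc, mul_add, h1, ← mul_assoc, h4, zero_mul, add_zero]
    rw [← e, mul_assoc, hcSr]
  have hSs : ∀ k, S * s k = s k := fun k => by
    induction k with
    | zero => rw [hs0, mul_zero]
    | succ k ih => rw [hs1, mul_add, ih, hSc]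
  have hSd : ∀ n, S * d n = d n * S := fun n => by
    have e1 := hcS (d n - S * d n) fun k => by
      rw [sub_mul, mul_assoc, ← hcd, ← mul_assoc, hSc, sub_self]
    rw [sub_mul, sub_eq_zero] at e1
    have e2 := congrArg star e1
    simp only [star_mul, hS.1, (hd n).1] at e2
    rw [e2, ← mul_assoc, ← e1]
  have htl : ∀ n, d n * (d n - S * d n) = d n - S * d n := fun n => by
    rw [hSd, mul_sub, ← mul_assoc, (hd n).2]
  have hts : ∀ n k, (d n - S * d n) * s k = 0 := fun n k => by
    rw [hSd, sub_mul, mul_assoc, hSs, sub_self]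
  have hst : ∀ n k, s k * (d n - S * d n) = 0 := fun n k => by
    have := congrArg star (hts n k)
    rwa [star_mul, star_sub, star_mul, (hd n).1, hS.1, (hsP k).1, ← hSd,
      star_zero] at this
  have htr : ∀ n, (d n - S * d n) * d n = d n - S * d n := fun n => by
    rw [sub_mul, mul_assoc, (hd n).2]
  have htv : ∀ n k, (d n - S * d n) * v k = 0 := fun n k => by
    rw [hSd, sub_mul, mul_assoc, hSv, sub_self]
  refine ⟨fun k => k.unpair.1, fun k => k.unpair.2, v, fun n => d n - S * d n, ?_⟩
  refine
    { proj := fun n => ⟨?_, ?_⟩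
      mul_rem := htl
      rem_mul_mul_rem := fun m n hmn => ?_
      partial_isometry := h1
      mul_right := fun k => by rw [hv]; exact hVd _ _
      mul_left := fun k => by rw [hv]; exact hdV _ _
      mul_star := hvstar
      star_mul := hstarv
      mul := hvv
      rem_mul := htv
      mul_rem_eq_zero := fun k n => by rw [mul_sub, ← mul_assoc, hvS, sub_self]
      complete := fun n y ht h5 h6 => ?_ }
  · rw [star_sub, star_mul, (hd n).1, hS.1, hSd]
  · have e : (d n - S * d n) * S = 0 := by rw [hSd, sub_mul, mul_assoc, hS.2, sub_self]
    rw [mul_sub, htr, ← mul_assoc, e, zero_mul, sub_zero]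
  · obtain ⟨k, hk⟩ : ∃ k, k = Nat.pair m n := ⟨_, rfl⟩
    have e := hVx (F k) k (by simpa [hk] using hmn)
    have e1 : (F k).1 = s k := by rw [hs]
    have e2 : V (F k) k = v k := by rw [hv]
    have e3 : k.unpair.1 = m := by simp [hk]
    have e4 : k.unpair.2 = n := by simp [hk]
    rw [e1, e2, e3, e4] at e
    have e5 : (d m - S * d m) * (d m - s k * d m) = d m - S * d m := by
      rw [mul_sub, htr, ← mul_assoc, hts, zero_mul, sub_zero]
    have e6 : (d n - s k * d n) * (d n - S * d n) = d n - S * d n := by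
      rw [sub_mul, htl, mul_assoc, htl, hst, sub_zero]
    calc (d m - S * d m) * u n * (d n - S * d n)
        = (d m - S * d m) * ((d m - s k * d m) * u n * (d n - s k * d n)) * (d n - S * d n) := by
          rw [← mul_assoc, ← mul_assoc, e5, mul_assoc _ (d n - s k * d n), e6]
      _ = 0 := by rw [← e, mul_assoc (v k), mul_mul_of_mul_eq (htv m k), zero_mul, zero_mul]
  · have e := hcS y fun k => by
      simp only [hc, mul_add, ← mul_assoc, h5, h6, zero_mul, add_zero]
    rwa [mul_sub, ← mul_assoc, e, zero_mul, sub_zero] at ht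

end Splitting

section Reduction

variable {A : Type*} [NonUnitalCStarAlgebra A] {d u v x : ℕ → A} {i j : ℕ → ℕ}

theorem IsTransfer.adjoint (hd : ∀ n, IsProjection (d n)) (hv : IsTransfer d i j v) :
    IsTransfer d j i fun k => star (v k) where
  partial_isometry k := by
    simpa [mul_assoc] using congrArg star (hv.partial_isometry k)
  mul_right k := by simpa [(hd _).1] using congrArg star (hv.mul_left k)
  mul_left k := by simpa [(hd _).1] using congrArg star (hv.mul_right k)
  mul_star k l h := by simpa using hv.star_mul k l h
  star_mul k l h := by simpa using hv.mul_star k l h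
  mul k l := by simpa using congrArg star (hv.mul l k)

theorem IsTransfer.initial_mul_initial (hv : IsTransfer d i j v) {k l : ℕ} (h : k ≠ l) :
    star (v k) * v k * (star (v l) * v l) = 0 := by
  rw [mul_assoc, mul_mul_of_mul_eq (hv.mul_star k l h), zero_mul, mul_zero]

theorem IsTransfer.isProjection (hv : IsTransfer d i j v) (k : ℕ) :
    IsProjection (star (v k) * v k) :=
  isProjection_star_mul_self (hv.partial_isometry k)

theorem IsTransfer.mul_initial (hd : ∀ n, IsProjection (d n)) (hv : IsTransfer d i j v)
    (k : ℕ) : d (j k) * (star (v k) * v k) = star (v k) * v k := by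
  rw [← mul_assoc, (hv.adjoint hd).mul_left]

namespace IsOrthoFamily

/-- Gram matrix of cut-downs of a family with orthogonal final projections. -/
theorem star_mul_cut {c : ℕ → A} (hu : ∀ n, star (x n) * x n = d n)
    (ho : ∀ m n, m ≠ n → star (x m) * x n = 0)
    (hc : ∀ k, IsProjection (c k)) (hdc : ∀ k, d (j k) * c k = c k)
    (hco : ∀ k l, k ≠ l → c k * c l = 0) :
    (∀ k, star (x (j k) * c k) * (x (j k) * c k) = c k) ∧
      ∀ k l, k ≠ l → star (x (j k) * c k) * (x (j l) * c l) = 0 := by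
  refine ⟨fun k => ?_, fun k l hkl => ?_⟩
  · rw [star_mul, (hc k).1, mul_assoc, mul_mul_of_mul_eq (hu _), hdc, (hc k).2]
  · rw [star_mul, (hc k).1, mul_assoc]
    by_cases h : j k = j l
    · rw [h, mul_mul_of_mul_eq (hu _), hdc, hco k l hkl]
    · rw [mul_mul_of_mul_eq (ho _ _ h), zero_mul, mul_zero]

theorem cut {c : ℕ → A} (hu : IsOrthoFamily u) (hc : ∀ k, IsProjection (c k))
    (hdc : ∀ k, star (u (j k)) * u (j k) * c k = c k) (hco : ∀ k l, k ≠ l → c k * c l = 0) :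
    IsOrthoFamily fun k => u (j k) * c k := by
  obtain ⟨h1, h2⟩ := star_mul_cut (d := fun n => star (u n) * u n) (fun _ => rfl) hu.left
    hc hdc hco
  refine ⟨fun k => by rw [h1]; exact hc k, h2, fun k l hkl => ?_⟩
  rw [star_mul, (hc l).1, mul_assoc, mul_mul_of_mul_eq (hco k l hkl), zero_mul, mul_zero]

theorem star_cut_mul_cut (hu : IsOrthoFamily u) (hv : IsTransfer (fun n => star (u n) * u n) i j v)
    (k : ℕ) :
    star (u (j k) * (star (v k) * v k)) * (u (j k) * (star (v k) * v k)) = star (v k) * v k :=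
  (star_mul_cut (fun _ => rfl) hu.left hv.isProjection (hv.mul_initial hu.proj)
    fun _ _ => hv.initial_mul_initial).1 k

theorem cut_transfer (hu : IsOrthoFamily u)
    (hv : IsTransfer (fun n => star (u n) * u n) i j v) :
    IsOrthoFamily fun k => u (j k) * (star (v k) * v k) :=
  hu.cut hv.isProjection (hv.mul_initial hu.proj) fun _ _ => hv.initial_mul_initial

theorem isCopy_transfer (hu : IsOrthoFamily u)
    (hv : IsTransfer (fun n => star (u n) * u n) i j v) :
    IsCopy (fun k => u (j k) * (star (v k) * v k)) v where
  eq k := (hu.star_cut_mul_cut hv k).symm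
  left := hv.star_mul
  mul m n := by simp only [mul_assoc, hv.mul, mul_zero]

variable [PartialOrder A] [StarOrderedRing A]

theorem isAddable_of_transfers (hA : WeaklyRickart A) (hu : IsOrthoFamily u)
    (H : ∀ i j v, IsTransfer (fun n => star (u n) * u n) i j v →
      IsAddable fun k => u (j k) * (star (v k) * v k)) : IsAddable u := by
  obtain ⟨i, j, v, t, h⟩ := hA.exists_splitting hu.proj (fun _ _ => hu.initial_mul_initial) u
  have hv := h.toIsTransfer
  have hv' := hv.adjoint hu.proj
  have htd : ∀ n, t n * (star (u n) * u n) = t n := fun n => by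
    simpa [(h.proj n).1, mul_assoc] using congrArg star (h.mul_rem n)
  have hto : ∀ m n, m ≠ n → t m * t n = 0 := fun m n hmn => by
    rw [← htd m, mul_assoc, ← h.mul_rem n, mul_mul_of_mul_eq (hu.initial_mul_initial hmn),
      zero_mul, mul_zero]
  have htf : IsOrthoFamily fun n => u n * t n := hu.cut (j := id) h.proj h.mul_rem hto
  obtain ⟨Wa, hWa⟩ := H i j v hv
  obtain ⟨Wb, hWb⟩ := H j i _ hv'
  obtain ⟨Wt, hWt⟩ := htf.isAddable_of_mul_eq_zero hA fun m n hmn => by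
    rw [mul_assoc, ← mul_assoc (t m), h.rem_mul_mul_rem m n hmn, mul_zero]
  have hWa' : ∀ k, Wa * (star (v k) * v k) = u (j k) * (star (v k) * v k) := fun k => by
    have := hWa k
    rwa [hu.star_cut_mul_cut hv] at this
  have hWb' : ∀ k, Wb * (v k * star (v k)) = u (i k) * (v k * star (v k)) := fun k => by
    have := hWb k
    rw [hu.star_cut_mul_cut hv'] at this
    simpa only [star_star] using this
  have hWt' : ∀ n, Wt * t n = u n * t n := fun n => by
    have e := (star_mul_cut (j := id) (fun _ => rfl) hu.left h.proj h.mul_rem hto).1 n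
    have := hWt n
    rwa [show star (u n * t n) * (u n * t n) = t n from e] at this
  obtain ⟨a, ha, hav, hay⟩ := hA.exists_sup hv.isProjection fun _ _ => hv.initial_mul_initial
  obtain ⟨b, hb, hbv, hby⟩ := hA.exists_sup hv'.isProjection fun _ _ => hv'.initial_mul_initial
  obtain ⟨e, he, het, hey⟩ := hA.exists_sup h.proj hto
  simp only [star_star] at hbv hby
  have hzero : ∀ {r : ℕ → A} {s z : A}, (∀ n, star (r n) = r n) → star s = s →
      (∀ y, (∀ n, y * r n = 0) → y * s = 0) → (∀ n, r n * z = 0) → s * z = 0 := by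
    intro r s z hr hs hy hz
    have := hy (star z) fun n => by simpa [hr] using congrArg star (hz n)
    simpa [hs] using congrArg star this
  have ha0 : ∀ {z}, (∀ k, v k * z = 0) → a * z = 0 := fun hz =>
    hzero (fun k => (hv.isProjection k).1) ha.1 hay fun k => by rw [mul_assoc, hz, mul_zero]
  have hb0 : ∀ {z}, (∀ k, star (v k) * z = 0) → b * z = 0 := fun hz =>
    hzero (fun k => by simp) hb.1 hby fun k => by rw [mul_assoc, hz, mul_zero]
  have he0 : ∀ {z}, (∀ k, t k * z = 0) → e * z = 0 := hzero (fun k => (h.proj k).1) he.1 hey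
  have hvt : ∀ k n, star (v k) * t n = 0 := fun k n => by
    simpa [(h.proj n).1] using congrArg star (h.rem_mul n k)
  have htv : ∀ n k, t n * star (v k) = 0 := fun n k => by
    simpa [(h.proj n).1] using congrArg star (h.mul_rem_eq_zero k n)
  have hpi : ∀ k, star (v k) * v k * star (v k) = star (v k) := fun k => by
    simpa [mul_assoc] using hv'.partial_isometry k
  have hpi' : ∀ k, v k * star (v k) * v k = v k := fun k => by
    simpa [mul_assoc] using hv.partial_isometry k
  refine ⟨Wa * a + Wb * b + Wt * e, fun n => ?_⟩
  have key : ∀ m z, star (u m) * u m * z = z → (Wa * a + Wb * b + Wt * e) * z = u m * z →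
      ((Wa * a + Wb * b + Wt * e) * (star (u n) * u n) - u n) * z = 0 := by
    intro m z hm hz
    rcases eq_or_ne n m with rfl | hnm
    · rw [sub_mul, mul_assoc, hm, hz, sub_self]
    · rw [← hm, sub_mul, mul_assoc, mul_mul_of_mul_eq (hu.initial_mul_initial hnm),
        mul_mul_of_mul_eq (hu.mul_initial_of_ne hnm), zero_mul, mul_zero, sub_zero]
  have := h.complete n _ (key n (t n) (h.mul_rem n) ?_) (fun k => key (i k) _ (hv.mul_left k) ?_)
    fun k => key (j k) _ (hv'.mul_left k) ?_
  · rwa [sub_mul, mul_assoc, (hu.proj n).2, hu.mul_initial, sub_eq_zero] at this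
  · rw [add_mul, add_mul, mul_assoc, ha0 fun k => h.mul_rem_eq_zero k n, mul_assoc,
      hb0 fun k => hvt k n, mul_assoc, het, hWt', mul_zero, mul_zero, zero_add, zero_add]
  · have e1 : b * v k = v k := by
      rw [← hpi' k, ← mul_assoc, hbv]
    have e2 : Wb * v k = u (i k) * v k := by
      rw [← hpi' k, ← mul_assoc, hWb', mul_assoc (u (i k))]
    rw [add_mul, add_mul, mul_assoc, ha0 fun l => hv.mul l k, mul_assoc, e1, mul_assoc,
      he0 fun n => h.rem_mul n k, e2, mul_zero, mul_zero, zero_add, add_zero]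
  · have e1 : a * star (v k) = star (v k) := by
      rw [← hpi k, ← mul_assoc, hav]
    have e2 : Wa * star (v k) = u (j k) * star (v k) := by
      rw [← hpi k, ← mul_assoc, hWa', mul_assoc (u (j k))]
    rw [add_mul, add_mul, mul_assoc, e1, mul_assoc, hb0 fun l => hv'.mul l k, mul_assoc,
      he0 fun n => htv n k, e2, mul_zero, mul_zero, add_zero, add_zero]

theorem isAddable_of_copy (hA : WeaklyRickart A) (hu : IsOrthoFamily u) (hx : IsCopy u x) :
    IsAddable u := by
  refine hu.isAddable_of_transfers hA fun i j v hv => ?_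
  obtain ⟨h1, h2⟩ := star_mul_cut (d := fun n => star (u n) * u n) hx.eq hx.left hv.isProjection
    (hv.mul_initial hu.proj) fun _ _ => hv.initial_mul_initial
  have hxd : ∀ m n, star (x m) * (star (u n) * u n) = 0 := fun m n => by
    have : star (u n) * u n * x m = 0 := by rw [mul_assoc, hx.mul, mul_zero]
    simpa using congrArg star this
  refine (hu.cut_transfer hv).isAddable_of_two_copies hA
    (x := fun k => x (j k) * (star (v k) * v k)) (y := v)
    ⟨fun k => by rw [h1, hu.star_cut_mul_cut hv], h2, fun m n => ?_⟩ (hu.isCopy_transfer hv)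
    fun m n => ?_
  · have : star (v m) * v m * x (j n) = 0 := by
      rw [← hv.mul_right m, mul_assoc, mul_assoc, mul_assoc, hx.mul, mul_zero, mul_zero, mul_zero]
    rw [mul_assoc, mul_mul_of_mul_eq this, zero_mul, mul_zero]
  · rw [star_mul, mul_assoc, ← hv.mul_left n, mul_mul_of_mul_eq (hxd _ _), zero_mul, mul_zero]

/-- In a weakly Rickart C*-algebra, partial isometries with pairwise orthogonal initial and final
projections can be added up. -/
theorem isAddable (hA : WeaklyRickart A) (hu : IsOrthoFamily u) : IsAddable u :=
  hu.isAddable_of_transfers hA fun _ _ _ hv =>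
    (hu.cut_transfer hv).isAddable_of_copy hA (hu.isCopy_transfer hv)

end IsOrthoFamily

end Reduction

section Polar

variable {A : Type*} [NonUnitalCStarAlgebra A]

theorem IsALP.commute_of_isSelfAdjoint {b h f : A} (hf : IsALP h f) (hb : star b = b)
    (hbh : b * h = h * b) : b * f = f * b := by
  have e1 := hf.eq_of_mul_eq (y := b) (z := f * b) (by
    rw [mul_assoc, hbh, ← mul_assoc, hf.2.1])
  have e2 := congrArg star e1
  simp only [star_mul, hf.1.1, hb] at e2
  rw [e2, ← mul_assoc, ← e1]

variable [PartialOrder A] [StarOrderedRing A]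

/-- Truncations `(b - ε)₊` of a positive element `b`, on whose supports `b` has an inverse. -/
theorem exists_truncation {b : A} (hb : 0 ≤ b) {ε : ℝ} (hε : 0 < ε) :
    ∃ h k : A, h = cfcₙ (fun t : ℝ => max (t - ε) 0) b ∧ star h = h ∧ star k = k ∧
      b * h = h * b ∧ b * k = k * b ∧ b * k * h = h ∧ ‖b - h‖ ≤ ε := by
  have hbs : IsSelfAdjoint b := hb.isSelfAdjoint
  have hf : Continuous fun t : ℝ => max (t - ε) 0 := by fun_prop
  have hf0 : max ((0 : ℝ) - ε) 0 = 0 := by simp [hε.le]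
  have hg : Continuous fun t : ℝ => t / max t ε ^ 2 :=
    continuous_id.div (by fun_prop) fun t => pow_ne_zero 2 (lt_max_of_lt_right hε).ne'
  have hid : b = cfcₙ (fun t : ℝ => t) b := (cfcₙ_id' ℝ b).symm
  refine ⟨_, cfcₙ (fun t : ℝ => t / max t ε ^ 2) b, rfl, (cfcₙ_predicate _ b : IsSelfAdjoint _),
    (cfcₙ_predicate _ b : IsSelfAdjoint _), ?_, ?_, ?_, ?_⟩
  · nth_rewrite 1 4 [hid]
    exact cfcₙ_commute_cfcₙ _ _ b
  · nth_rewrite 1 4 [hid]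
    exact cfcₙ_commute_cfcₙ _ _ b
  · nth_rewrite 1 [hid]
    rw [← cfcₙ_mul (fun t : ℝ => t) _ b continuousOn_id rfl hg.continuousOn (by simp),
      ← cfcₙ_mul (fun t : ℝ => t * (t / max t ε ^ 2)) _ b
        (continuous_id.mul hg).continuousOn (by simp) hf.continuousOn hf0]
    refine cfcₙ_congr fun t _ => ?_
    rcases le_total t ε with h | h
    · simp [h]
    · have : t ≠ 0 := (hε.trans_le h).ne'
      simp only [max_eq_left h]
      field_simp
  · nth_rewrite 1 [hid]
    rw [← cfcₙ_sub (fun t : ℝ => t) _ b continuousOn_id rfl hf.continuousOn hf0]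
    refine norm_cfcₙ_le fun t ht => ?_
    have ht0 : 0 ≤ t := quasispectrum_nonneg_of_nonneg b hb t ht
    rw [Real.norm_eq_abs, abs_le]
    rcases le_total t ε with h | h
    · rw [max_eq_right (by linarith)]; constructor <;> linarith
    · rw [max_eq_left (by linarith)]; constructor <;> linarith

theorem truncation_sq_le {b : A} {ε δ : ℝ} (hδ : 0 < δ) (h : δ ≤ ε) :
    cfcₙ (fun t : ℝ => max (t - ε) 0) b * cfcₙ (fun t : ℝ => max (t - ε) 0) b
      ≤ cfcₙ (fun t : ℝ => max (t - δ) 0) b * cfcₙ (fun t : ℝ => max (t - δ) 0) b := by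
  have hf : ∀ η : ℝ, Continuous fun t : ℝ => max (t - η) 0 := fun η => by fun_prop
  have hf0 : ∀ η : ℝ, 0 < η → max ((0 : ℝ) - η) 0 = 0 := fun η hη => by simp [hη.le]
  have hε := hδ.trans_le h
  rw [← cfcₙ_mul _ _ b (hf ε).continuousOn (hf0 ε hε) (hf ε).continuousOn (hf0 ε hε),
    ← cfcₙ_mul _ _ b (hf δ).continuousOn (hf0 δ hδ) (hf δ).continuousOn (hf0 δ hδ)]
  refine cfcₙ_mono (fun t _ => ?_) ((hf ε).mul (hf ε)).continuousOn
    ((hf δ).mul (hf δ)).continuousOn (by simp [hε.le]) (by simp [hδ.le])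
  have : max (t - ε) 0 ≤ max (t - δ) 0 := max_le_max (by linarith) le_rfl
  exact mul_le_mul this this (le_max_right _ _) (le_max_right _ _)

/-- In a weakly Rickart C*-algebra, `a` factors through every positive `b` with
`a* a = b²`. -/
theorem WeaklyRickart.exists_mul_eq_of_star_mul_self_eq (hA : WeaklyRickart A) {a b : A}
    (hb : 0 ≤ b) (hab : star a * a = b * b) : ∃ W : A, W * b = a := by
  have hbs : star b = b := hb.isSelfAdjoint
  choose h k hh hhs hks hbh hbk hbkh hnorm using fun n : ℕ =>
    exists_truncation hb (Nat.one_div_pos_of_nat (α := ℝ) (n := n))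
  choose f hf using fun n => hA.exists_isALP (h n)
  have hfP : ∀ n, IsProjection (f n) := fun n => (hf n).1
  have hff : ∀ n, f (n + 1) * f n = f n := fun n => by
    refine (hf n).mul_mul_eq ?_
    have e1 : h (n + 1) * f (n + 1) = h (n + 1) := by
      simpa [hhs, (hfP _).1] using congrArg star (hf (n + 1)).2.1
    have e2 : h n * f (n + 1) = h n := by
      refine mul_eq_of_star_mul_self_le (hfP _) ?_ e1
      rw [hhs, hhs, hh, hh]
      exact truncation_sq_le Nat.one_div_pos_of_nat (Nat.one_div_le_one_div n.le_succ)
    simpa [hhs, (hfP _).1] using congrArg star e2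
  have hff' : ∀ n, f n * f (n + 1) = f n := fun n => by
    simpa [(hfP _).1] using congrArg star (hff n)
  obtain ⟨r, hr0, hr1⟩ : ∃ r : ℕ → A, r 0 = f 0 ∧ ∀ n, r (n + 1) = f (n + 1) - f n :=
    ⟨fun n => Nat.casesOn n (f 0) fun n => f (n + 1) - f n, rfl, fun _ => rfl⟩
  have hrP : ∀ n, IsProjection (r n) := fun n => by
    cases n with
    | zero => rw [hr0]; exact hfP 0
    | succ n =>
      rw [hr1]
      refine ⟨by rw [star_sub, (hfP _).1, (hfP _).1], ?_⟩
      rw [sub_mul, mul_sub, mul_sub, (hfP _).2, (hfP _).2, hff, hff', sub_self, sub_zero]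
  have hfr : ∀ n, f n * r n = r n := fun n => by
    cases n with
    | zero => rw [hr0, (hfP 0).2]
    | succ n => rw [hr1, mul_sub, (hfP _).2, hff]
  have hfr' : ∀ m n, m < n → f m * r n = 0 := by
    have hle : ∀ m n, m ≤ n → f m * f n = f m := fun m n hmn => by
      induction n, hmn using Nat.le_induction with
      | base => exact (hfP m).2
      | succ n _ ih => rw [← ih, mul_assoc, hff']
    intro m n hmn
    obtain ⟨n, rfl⟩ := Nat.exists_eq_succ_of_ne_zero (Nat.ne_zero_of_lt hmn)
    rw [Nat.succ_eq_add_one, hr1, mul_sub, hle _ _ hmn.le, hle _ _ (Nat.lt_succ_iff.mp hmn),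
      sub_self]
  have hrf : ∀ n, r n * f n = r n := fun n => by
    simpa [(hfP n).1, (hrP n).1] using congrArg star (hfr n)
  have hro' : ∀ m n, m < n → r m * r n = 0 := fun m n hmn => by
    rw [← hrf, mul_assoc, hfr' m n hmn, mul_zero]
  have hro : ∀ m n, m ≠ n → r m * r n = 0 := fun m n hmn => by
    rcases hmn.lt_or_gt with hlt | hlt
    · exact hro' m n hlt
    · simpa [(hrP _).1] using congrArg star (hro' n m hlt)
  have hbkr : ∀ n, b * (k n * r n) = r n := fun n => by
    rw [← mul_assoc, ← hfr, ← mul_assoc, (hf n).mul_mul_eq (hbkh n)]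
  have hkbr : ∀ n, k n * (b * r n) = r n := fun n => by
    rw [← mul_assoc, ← hbk, mul_assoc, hbkr]
  have hrkb : ∀ n, r n * k n * b = r n := fun n => by
    simpa [hbs, hks, (hrP n).1] using congrArg star (hbkr n)
  have hbf : ∀ n, b * f n = f n * b := fun n => (hf n).commute_of_isSelfAdjoint hbs (hbh n)
  have hbr : ∀ n, b * r n = r n * b := fun n => by
    cases n with
    | zero => rw [hr0, hbf]
    | succ n => rw [hr1, mul_sub, sub_mul, hbf, hbf]
  have hgram : ∀ m n, star (a * (k m * r m)) * (a * (k n * r n)) = r m * r n := fun m n => by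
    calc star (a * (k m * r m)) * (a * (k n * r n))
        = r m * k m * (star a * a) * (k n * r n) := by
          simp only [star_mul, hks, (hrP m).1, mul_assoc]
      _ = r m * r n := by rw [hab, ← mul_assoc (r m * k m) b b, hrkb, mul_assoc, hbkr]
  have hu : IsOrthoFamily fun n => a * (k n * r n) :=
    { proj := fun n => by rw [hgram, (hrP n).2]; exact hrP n
      left := fun m n hmn => by rw [hgram, hro m n hmn]
      right := fun m n hmn => by
        simp only [star_mul, (hrP n).1, mul_assoc, mul_mul_of_mul_eq (hro m n hmn), zero_mul,
          mul_zero] }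
  obtain ⟨W, hW⟩ := hu.isAddable hA
  simp only [hgram, (hrP _).2] at hW
  have hcr : ∀ n, (W * b - a) * r n = 0 := fun n => by
    rw [sub_mul, mul_assoc, hbr, ← mul_assoc, hW, mul_assoc, mul_assoc, ← hbr, hkbr, sub_self]
  have hcf : ∀ n, (W * b - a) * f n = 0 := fun n => by
    induction n with
    | zero => rw [← hr0, hcr]
    | succ n ih =>
      have := hcr (n + 1)
      rwa [hr1, mul_sub, ih, sub_zero] at this
  have hch : ∀ n, (W * b - a) * h n = 0 := fun n => by
    rw [← (hf n).2.1, ← mul_assoc, hcf, zero_mul]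
  have hlim : Filter.Tendsto h Filter.atTop (nhds b) := by
    rw [tendsto_iff_norm_sub_tendsto_zero]
    refine squeeze_zero (fun _ => norm_nonneg _) (fun n => ?_)
      tendsto_one_div_add_atTop_nhds_zero_nat
    rw [norm_sub_rev]
    exact hnorm n
  have hcb : (W * b - a) * b = 0 :=
    tendsto_nhds_unique (hlim.const_mul _) (by simp only [hch]; exact tendsto_const_nhds)
  obtain ⟨e, he⟩ := hA.exists_isALP b
  have hbe : b * e = b := by simpa [hbs, he.1.1] using congrArg star he.2.1
  have hae : a * e = a := mul_eq_of_star_mul_self_le he.1 (by rw [hab, hbs]) hbe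
  refine ⟨W, ?_⟩
  have := he.2.2 _ hcb
  rwa [sub_mul, mul_assoc, hbe, hae, sub_eq_zero] at this

end Polar

/-- Every element `x` of a weakly Rickart C*-algebra admits a polar decomposition
inside `A`: there is a partial isometry `e ∈ A` with `x = e (x* x)^{1/2}`,
`e e* = LP(x)` and `e* e = RP(x)`. -/
theorem polar_decomposition_in_weakly_Rickart {A : Type*} [NonUnitalCStarAlgebra A]
    [PartialOrder A] [StarOrderedRing A]
    (hA : WeaklyRickart A) (x : A) :
    ∃ e : A, IsPartialIsometry e ∧
      x = e * CFC.sqrt (star x * x) ∧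
      IsALP x (e * star e) ∧ IsARP x (star e * e) := by
  obtain ⟨b, hb⟩ : ∃ b, b = CFC.sqrt (star x * x) := ⟨_, rfl⟩
  have hb0 : 0 ≤ b := hb ▸ CFC.sqrt_nonneg _
  have hbs : star b = b := hb0.isSelfAdjoint
  have hbb : star x * x = b * b := by
    rw [hb, CFC.sqrt_mul_sqrt_self _ (star_mul_self_nonneg x)]
  obtain ⟨W, hW⟩ := hA.exists_mul_eq_of_star_mul_self_eq hb0 hbb
  obtain ⟨e, he, heb, hex⟩ := hA.exists_partialIsometry (by rw [hbb, hbs]) hW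
  refine ⟨e, hex.1, by rw [← hb, he], hex, heb.1, ?_, fun y hy => ?_⟩
  · rw [← he, mul_assoc]
    congr 1
    simpa [hbs] using congrArg star heb.2.1
  · refine heb.mul_of_star_mul_eq_zero ?_
    have : b * y = 0 := mul_eq_zero_of_star_mul_self_le (by rw [hbs, hbb]) hy
    simpa [hbs] using congrArg star this
end

section
/- A C*-algebra A is a Rickart C*-algebra if and only if the following holds: for every hereditary C*-subalgebra B of A and every positive x ∈ A such that, writing C for the norm closure of {x a x : a ∈ A}, one has b c = 0 and c b = 0 for all b ∈ B and c ∈ C, there exists a positive element e ∈ A with e b = b e = b for all b ∈ B and e c = c e = 0 for all c ∈ C. -/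
/-- A C*-algebra is Rickart if the right annihilator of every singleton is of the
form `p A` for a projection `p`. -/
def IsRickart (A : Type*) [NonUnitalCStarAlgebra A] : Prop :=
  ∀ x : A, ∃ p : A, IsProjection p ∧
    {y : A | x * y = 0} = {z : A | ∃ a : A, z = p * a}

/-- A hereditary C*-subalgebra: a norm-closed *-subalgebra `B` such that `0 ≤ a ≤ b`
with `b ∈ B` implies `a ∈ B`. -/
def IsHereditary {A : Type*} [NonUnitalCStarAlgebra A] [PartialOrder A]
    (B : NonUnitalStarSubalgebra ℂ A) : Prop :=
  IsClosed (B : Set A) ∧ ∀ a b : A, 0 ≤ a → a ≤ b → b ∈ B → a ∈ B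

/-- If `x ^ 3 * b = 0` for a self-adjoint `x`, then `x * b = 0`. -/
theorem IsSelfAdjoint.mul_eq_zero_of_cube_mul_eq_zero {A : Type*} [NonUnitalCStarAlgebra A]
    {x b : A} (hx : IsSelfAdjoint x) (h : x * x * x * b = 0) : x * b = 0 := by
  have hsq : x * (x * b) = 0 := by
    rw [← CStarRing.star_mul_self_eq_zero_iff]
    calc star (x * (x * b)) * (x * (x * b)) = star b * (x * (x * x * x * b)) := by
          simp only [star_mul, hx.star_eq, mul_assoc]
      _ = 0 := by rw [h, mul_zero, mul_zero]
  rw [← CStarRing.star_mul_self_eq_zero_iff, star_mul, hx.star_eq, mul_assoc, hsq, mul_zero]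

/-- If `0 ≤ a ≤ b` and `b * x = 0`, then `a * x = 0`. -/
theorem mul_eq_zero_of_nonneg_of_le {A : Type*} [NonUnitalCStarAlgebra A] [PartialOrder A]
    [StarOrderedRing A] {a b x : A} (ha : 0 ≤ a) (hab : a ≤ b) (h : b * x = 0) :
    a * x = 0 := by
  have hconj : star x * a * x = 0 := by
    refine le_antisymm ?_ (star_left_conjugate_nonneg ha x)
    have hle := star_left_conjugate_le_conjugate hab x
    rwa [mul_assoc _ b, h, mul_zero] at hle
  obtain ⟨s, rfl⟩ := CStarAlgebra.nonneg_iff_eq_star_mul_self.mp ha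
  have hs : s * x = 0 := by
    rw [← CStarRing.star_mul_self_eq_zero_iff, star_mul]
    simpa only [mul_assoc] using hconj
  rw [mul_assoc, hs, mul_zero]

/-- The two-sided annihilator of a self-adjoint element, as a star subalgebra. -/
def selfAdjointAnnihilator {A : Type*} [NonUnitalCStarAlgebra A] (x : A)
    (hx : IsSelfAdjoint x) : NonUnitalStarSubalgebra ℂ A where
  carrier := {b | x * b = 0 ∧ b * x = 0}
  add_mem' := by
    rintro a b ⟨ha, ha'⟩ ⟨hb, hb'⟩
    exact ⟨by rw [mul_add, ha, hb, add_zero], by rw [add_mul, ha', hb', add_zero]⟩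
  zero_mem' := ⟨mul_zero x, zero_mul x⟩
  mul_mem' := by
    rintro a b ⟨ha, _⟩ ⟨_, hb'⟩
    exact ⟨by rw [← mul_assoc, ha, zero_mul], by rw [mul_assoc, hb', mul_zero]⟩
  smul_mem' := by
    rintro c a ⟨ha, ha'⟩
    exact ⟨by rw [mul_smul_comm, ha, smul_zero], by rw [smul_mul_assoc, ha', smul_zero]⟩
  star_mem' := by
    rintro a ⟨ha, ha'⟩
    exact ⟨by rw [← hx.star_eq, ← star_mul, ha', star_zero],
      by rw [← hx.star_eq, ← star_mul, ha, star_zero]⟩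

theorem mem_selfAdjointAnnihilator {A : Type*} [NonUnitalCStarAlgebra A] {x : A}
    {hx : IsSelfAdjoint x} {b : A} :
    b ∈ selfAdjointAnnihilator x hx ↔ x * b = 0 ∧ b * x = 0 :=
  Iff.rfl

theorem isHereditary_selfAdjointAnnihilator {A : Type*} [NonUnitalCStarAlgebra A]
    [PartialOrder A] [StarOrderedRing A] (x : A) (hx : IsSelfAdjoint x) :
    IsHereditary (selfAdjointAnnihilator x hx) := by
  refine ⟨?_, fun a b ha hab hb => ?_⟩
  · exact (isClosed_eq (continuous_const_mul x) continuous_const).inter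
      (isClosed_eq (continuous_mul_const x) continuous_const)
  · have hax : a * x = 0 := mul_eq_zero_of_nonneg_of_le ha hab hb.2
    refine ⟨?_, hax⟩
    rw [← (IsSelfAdjoint.of_nonneg ha).star_eq, ← hx.star_eq, ← star_mul, hax, star_zero]

/-- An element annihilating `x` on both sides annihilates the closure of `x A x`. -/
theorem mul_eq_zero_of_mem_closure_conjugates {A : Type*} [NonUnitalCStarAlgebra A] {x b c : A}
    (hxb : x * b = 0) (hbx : b * x = 0) (hc : c ∈ closure {w : A | ∃ a : A, w = x * a * x}) :
    b * c = 0 ∧ c * b = 0 := by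
  have hclosed : IsClosed {c : A | b * c = 0 ∧ c * b = 0} :=
    (isClosed_eq (continuous_const_mul b) continuous_const).inter
      (isClosed_eq (continuous_mul_const b) continuous_const)
  refine closure_minimal ?_ hclosed hc
  rintro _ ⟨a, rfl⟩
  exact ⟨by rw [← mul_assoc, ← mul_assoc, hbx, zero_mul, zero_mul],
    by rw [mul_assoc, hxb, mul_zero]⟩

/-- A C*-algebra `A` is a Rickart C*-algebra if, and only if: for every hereditary
C*-subalgebra `B` of `A` and every positive `x ∈ A` such that `B` and the norm closure
`C` of `x A x` annihilate each other, there exists a positive element `e ∈ A` which is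
a unit for `B` and annihilates `C`. -/
theorem rickart_iff_local_units_for_hereditary {A : Type*}
    [NonUnitalCStarAlgebra A] [PartialOrder A] [StarOrderedRing A] :
    IsRickart A ↔
      ∀ (B : NonUnitalStarSubalgebra ℂ A), IsHereditary B →
        ∀ x : A, 0 ≤ x →
          (∀ b ∈ B, ∀ c ∈ closure {w : A | ∃ a : A, w = x * a * x},
            b * c = 0 ∧ c * b = 0) →
          ∃ e : A, 0 ≤ e ∧
            (∀ b ∈ B, e * b = b ∧ b * e = b) ∧
            (∀ c ∈ closure {w : A | ∃ a : A, w = x * a * x},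
              e * c = 0 ∧ c * e = 0) := by
  constructor
  · intro hA B _ x hx hBC
    have hxs := IsSelfAdjoint.of_nonneg hx
    obtain ⟨p, ⟨hps, hpp⟩, hp⟩ := hA x
    have hxp : x * p = 0 := hp.symm.subset ⟨p, hpp.symm⟩
    have hpx : p * x = 0 := by
      rw [← hps, ← hxs.star_eq, ← star_mul, hxp, star_zero]
    have hpB : ∀ b ∈ B, p * b = b := by
      intro b hb
      obtain ⟨a, rfl⟩ := hp.subset (hxs.mul_eq_zero_of_cube_mul_eq_zero
        (hBC b hb _ (subset_closure ⟨x, rfl⟩)).2)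
      rw [← mul_assoc, hpp]
    refine ⟨p, ?_, fun b hb => ⟨hpB b hb, ?_⟩,
      fun c hc => mul_eq_zero_of_mem_closure_conjugates hxp hpx hc⟩
    · simpa only [hps, hpp] using star_mul_self_nonneg p
    · simpa only [star_mul, star_star, hps] using congrArg star (hpB _ (star_mem hb))
  · intro h y
    have hx0 : 0 ≤ star y * y := star_mul_self_nonneg y
    have hxs := IsSelfAdjoint.of_nonneg hx0
    have hann : ∀ z : A, star y * y * z = 0 ↔ y * z = 0 := by
      intro z
      refine ⟨fun hz => ?_, fun hz => by rw [mul_assoc, hz, mul_zero]⟩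
      rw [← CStarRing.star_mul_self_eq_zero_iff, star_mul, mul_assoc, ← mul_assoc _ y, hz,
        mul_zero]
    obtain ⟨e, he0, heB, heC⟩ := h _ (isHereditary_selfAdjointAnnihilator _ hxs) _ hx0
      fun b hb c hc => mul_eq_zero_of_mem_closure_conjugates hb.1 hb.2 hc
    have hes := IsSelfAdjoint.of_nonneg he0
    have hxe : star y * y * e = 0 :=
      hxs.mul_eq_zero_of_cube_mul_eq_zero (heC _ (subset_closure ⟨star y * y, rfl⟩)).2
    have hex : e * (star y * y) = 0 := by
      simpa only [star_mul, star_star, star_zero, hes.star_eq, mul_assoc] using congrArg star hxe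
    refine ⟨e, ⟨hes.star_eq, (heB e ⟨hxe, hex⟩).1⟩, Set.ext fun z => ⟨fun hz => ⟨z, ?_⟩, ?_⟩⟩
    · have hyz : y * z = 0 := hz
      have hzz : z * star z ∈ selfAdjointAnnihilator (star y * y) hxs := by
        refine ⟨by rw [← mul_assoc, (hann z).2 hyz, zero_mul], ?_⟩
        rw [mul_assoc, ← mul_assoc (star z), ← star_mul, hyz, star_zero, zero_mul, mul_zero]
      obtain ⟨hl, hr⟩ := heB _ hzz
      rw [← sub_eq_zero, ← CStarRing.mul_star_self_eq_zero_iff]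
      calc (z - e * z) * star (z - e * z)
          = z * star z - e * (z * star z) - (z * star z * e - e * (z * star z) * e) := by
            simp only [star_sub, star_mul, hes.star_eq, sub_mul, mul_sub, mul_assoc]
        _ = 0 := by rw [hl, hr, sub_self]
    · rintro ⟨a, rfl⟩
      exact (hann _).1 (by rw [← mul_assoc, hxe, zero_mul])
end
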